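/- arXiv:2006.05618 — 2 statements merged into one kernel-verified Lean document; each statement's English description precedes it below -/
import Mathlib

section
/- Let M be a simple strong Harish-Chandra W(m+1,n)-module. Then either (1) M is a strongly cuspidal module, or (2) there exists θ ∈ GL_{m+1}(ℤ) and λ ∈ supp(M^θ) such that supp(M^θ) ⊂ λ + ℤ_+ε_0 + ℤε_1 + … + ℤε_m, and the subspace ⊕_{μ ∈ λ + ℤε_1 + … + ℤε_m} (M^θ)_μ is a simple cuspidal module over W(m,n) ⋉ R_m d_0. -/
open scoped BigOperators

namespace WSuper

noncomputable section

/-- Exponents of the Laurent (even) variables `t_1, …, t_m`. -/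
abbrev LExp (m : ℕ) := Fin m → ℤ
/-- Exponents of the Grassmann (odd) variables `ξ_1, …, ξ_n`. -/
abbrev GExp (n : ℕ) := Fin n → Bool

variable {m n : ℕ}

/-- Degree of a Grassmann monomial `ξ^s`. -/
def gdeg (s : GExp n) : ℕ := (Finset.univ.filter fun a => s a = true).card

/-- Number of inversions between `ξ^s` and `ξ^q`. -/
def invCount (s q : GExp n) : ℕ :=
  ((Finset.univ ×ˢ Finset.univ).filter
    fun p : Fin n × Fin n => s p.1 = true ∧ q p.2 = true ∧ p.2 < p.1).card

/-- The scalar `c` with `ξ^s · ξ^q = c · ξ^(s xor q)` in the exterior algebra. -/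
def mulSgn (s q : GExp n) : ℂ :=
  if ∃ a, s a = true ∧ q a = true then 0 else (-1 : ℂ) ^ invCount s q

/-- Exponent of the product of two (disjoint) Grassmann monomials. -/
def xorE (s q : GExp n) : GExp n := fun a => Bool.xor (s a) (q a)

/-- The scalar `c` with `∂_a (ξ^s) = c ξ^(s \ a)`. -/
def derC (a : Fin n) (s : GExp n) : ℂ :=
  if s a = true then (-1 : ℂ) ^ (Finset.univ.filter fun x => s x = true ∧ x < a).card else 0

/-- The exponent of `∂_a (ξ^s)`. -/
def derE (a : Fin n) (s : GExp n) : GExp n := Function.update s a false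

/-- Directions: `d_i = t_i ∂/∂t_i`, `∂_α = ∂/∂ξ_α`, and (when `b = true`) the extra
even direction `d_0` of `W(m,n) ⋉ A d_0`. -/
inductive Dir (m n : ℕ) : Bool → Type where
  | di {b : Bool} (i : Fin m) : Dir m n b
  | pa {b : Bool} (a : Fin n) : Dir m n b
  | d0 : Dir m n true

/-- The basis `t^r ξ^s D` of `W(m,n)` (for `b = false`) resp. of `W(m,n) ⋉ A d_0`
(for `b = true`). -/
abbrev WBasis (m n : ℕ) (b : Bool) := LExp m × GExp n × Dir m n b

/-- The Lie superalgebra `W(m,n)` (`b = false`) resp. `W(m,n) ⋉ A d_0` (`b = true`),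
as the free complex vector space on its standard basis. -/
abbrev W (m n : ℕ) (b : Bool) := WBasis m n b →₀ ℂ

def sng {b : Bool} (x : WBasis m n b) : W m n b := Finsupp.single x 1

/-- Parity (0 = even, 1 = odd) of a basis element. -/
def par {b : Bool} : WBasis m n b → ℕ
  | ⟨_, s, .di _⟩ => gdeg s % 2
  | ⟨_, s, .pa _⟩ => (gdeg s + 1) % 2
  | ⟨_, s, .d0⟩ => gdeg s % 2

/-- The super Lie bracket of `W(m,n)` (resp. `W(m,n) ⋉ A d_0`) on basis elements. -/
def brB {b : Bool} : WBasis m n b → WBasis m n b → W m n b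
  | ⟨r, s, .di i⟩, ⟨p, q, .di j⟩ =>
      ((p i : ℂ) * mulSgn s q) • sng ⟨r + p, xorE s q, .di j⟩
        - ((r j : ℂ) * mulSgn s q) • sng ⟨r + p, xorE s q, .di i⟩
  | ⟨r, s, .di i⟩, ⟨p, q, .pa β⟩ =>
      ((p i : ℂ) * mulSgn s q) • sng ⟨r + p, xorE s q, .pa β⟩
        - ((-1 : ℂ) ^ (gdeg s * (gdeg q + 1)) * derC β s * mulSgn q (derE β s)) •
            sng ⟨r + p, xorE q (derE β s), .di i⟩
  | ⟨r, s, .pa α⟩, ⟨p, q, .di j⟩ =>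
      (derC α q * mulSgn s (derE α q)) • sng ⟨r + p, xorE s (derE α q), .di j⟩
        - ((-1 : ℂ) ^ ((gdeg s + 1) * gdeg q) * (r j : ℂ) * mulSgn q s) •
            sng ⟨r + p, xorE q s, .pa α⟩
  | ⟨r, s, .pa α⟩, ⟨p, q, .pa β⟩ =>
      (derC α q * mulSgn s (derE α q)) • sng ⟨r + p, xorE s (derE α q), .pa β⟩
        - ((-1 : ℂ) ^ ((gdeg s + 1) * (gdeg q + 1)) * derC β s * mulSgn q (derE β s)) •
            sng ⟨r + p, xorE q (derE β s), .pa α⟩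
  | ⟨r, s, .di i⟩, ⟨p, q, .d0⟩ =>
      ((p i : ℂ) * mulSgn s q) • sng ⟨r + p, xorE s q, .d0⟩
  | ⟨r, s, .pa α⟩, ⟨p, q, .d0⟩ =>
      (derC α q * mulSgn s (derE α q)) • sng ⟨r + p, xorE s (derE α q), .d0⟩
  | ⟨r, s, .d0⟩, ⟨p, q, .di j⟩ =>
      (-(r j : ℂ) * mulSgn s q) • sng ⟨r + p, xorE s q, .d0⟩
  | ⟨r, s, .d0⟩, ⟨p, q, .pa β⟩ =>
      (-(-1 : ℂ) ^ (gdeg s * (gdeg q + 1)) * derC β s * mulSgn q (derE β s)) •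
          sng ⟨r + p, xorE q (derE β s), .d0⟩
  | ⟨_, _, .d0⟩, ⟨_, _, .d0⟩ => 0

/-- A module over the Lie superalgebra `W(m,n)` (resp. `W(m,n) ⋉ A d_0`):
a complex vector space with a linear action satisfying the super commutator rule. -/
structure WRep (m n : ℕ) (b : Bool) where
  M : Type
  [addgrp : AddCommGroup M]
  [mods : Module ℂ M]
  act : W m n b →ₗ[ℂ] M →ₗ[ℂ] M
  super : ∀ x y : WBasis m n b,
    act (brB x y)
      = act (sng x) ∘ₗ act (sng y)
        - ((-1 : ℂ) ^ (par x * par y)) • (act (sng y) ∘ₗ act (sng x))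

attribute [instance] WRep.addgrp WRep.mods

/-- A raw action of (the basis of) `W(m,n)` resp. `W(m,n) ⋉ A d_0` on a vector space. -/
abbrev GAct (m n : ℕ) (b : Bool) (M : Type) [AddCommGroup M] [Module ℂ M] :=
  WBasis m n b → M →ₗ[ℂ] M

/-- Index set for the Cartan subalgebra `h'`: the elements `d_1, …, d_m`,
together with `d_0` when `b = true`. -/
abbrev HIdx (m : ℕ) (b : Bool) := Fin m ⊕ Fin (cond b 1 0)

def hB (m n : ℕ) (b : Bool) : HIdx m b → WBasis m n b :=
  fun h => match b, h with
    | _, .inl i => ⟨0, fun _ => false, .di i⟩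
    | true, .inr _ => ⟨0, fun _ => false, .d0⟩
    | false, .inr j => j.elim0

/-- The basis element `ξ_a ∂_a` of the odd Cartan subalgebra `h''`. -/
def hppB (m n : ℕ) (b : Bool) (a : Fin n) : WBasis m n b :=
  ⟨0, fun x => decide (x = a), .pa a⟩

section Predicates

variable {M : Type} [AddCommGroup M] [Module ℂ M] {b : Bool}

/-- Weight space with respect to the even Cartan subalgebra `h'`. -/
def wtG (F : GAct m n b M) (lam : HIdx m b → ℂ) : Submodule ℂ M :=
  ⨅ h, LinearMap.ker (F (hB m n b h) - lam h • (LinearMap.id : M →ₗ[ℂ] M))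

/-- Weight space with respect to the full Cartan subalgebra `h = h' ⊕ h''`. -/
def wtFullG (F : GAct m n b M) (lam : HIdx m b → ℂ) (mu : Fin n → ℂ) : Submodule ℂ M :=
  wtG F lam ⊓
    ⨅ a, LinearMap.ker (F (hppB m n b a) - mu a • (LinearMap.id : M →ₗ[ℂ] M))

/-- Strong Harish-Chandra module: weight decomposition with respect to `h'`
with finite-dimensional weight spaces. -/
def IsStrongHCG (F : GAct m n b M) : Prop :=
  (⨆ lam, wtG F lam) = ⊤ ∧ ∀ lam, FiniteDimensional ℂ (wtG F lam)

/-- Harish-Chandra module: weight decomposition with respect to `h`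
with finite-dimensional weight spaces. -/
def IsHCG (F : GAct m n b M) : Prop :=
  (⨆ lam, ⨆ mu, wtFullG F lam mu) = ⊤ ∧
    ∀ lam mu, FiniteDimensional ℂ (wtFullG F lam mu)

/-- Strongly cuspidal: strong Harish-Chandra with uniformly bounded multiplicities. -/
def IsStronglyCuspidalG (F : GAct m n b M) : Prop :=
  IsStrongHCG F ∧ ∃ C : ℕ, ∀ lam, Module.finrank ℂ (wtG F lam) ≤ C

/-- Cuspidal: Harish-Chandra with uniformly bounded weight multiplicities. -/
def IsCuspidalG (F : GAct m n b M) : Prop :=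
  IsHCG F ∧ ∃ C : ℕ, ∀ lam mu, Module.finrank ℂ (wtFullG F lam mu) ≤ C

/-- The action of the odd Cartan subalgebra `h''` is diagonalizable. -/
def DiagHppG (F : GAct m n b M) : Prop :=
  (⨆ mu : Fin n → ℂ,
    ⨅ a, LinearMap.ker (F (hppB m n b a) - mu a • (LinearMap.id : M →ₗ[ℂ] M))) = ⊤

def InvariantG (F : GAct m n b M) (N : Submodule ℂ M) : Prop :=
  ∀ x : WBasis m n b, ∀ v ∈ N, F x v ∈ N

/-- Simplicity of a module, phrased via invariant subspaces. -/
def IsSimpleG (F : GAct m n b M) : Prop :=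
  (∃ v : M, v ≠ 0) ∧ ∀ N : Submodule ℂ M, InvariantG F N → N = ⊥ ∨ N = ⊤

end Predicates

/-- The action of basis elements attached to a representation. -/
def WRep.g {b : Bool} (ρ : WRep m n b) : GAct m n b ρ.M := fun x => ρ.act (sng x)

end

end WSuper

namespace WSuper

noncomputable section

variable {m n : ℕ}

/-- The automorphism of `W(m+1,n)` (here: of `W(m,n)` with `m` arbitrary) induced by
`θ ∈ GL_m(ℤ)` via `θ(t^s) = t^{θ s}`, on basis elements:
`θ(t^r ξ^s d_i) = Σ_j (θ⁻¹)_{ij} t^{θ r} ξ^s d_j`, `θ(t^r ξ^s ∂_a) = t^{θ r} ξ^s ∂_a`. -/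
def twB (θ : Matrix.GeneralLinearGroup (Fin m) ℤ) :
    WBasis m n false → W m n false
  | ⟨r, s, .di i⟩ =>
      ∑ j : Fin m, ((((θ⁻¹ : Matrix.GeneralLinearGroup (Fin m) ℤ) : Matrix (Fin m) (Fin m) ℤ) i j : ℂ)) •
        sng ⟨(θ : Matrix (Fin m) (Fin m) ℤ).mulVec r, s, .di j⟩
  | ⟨r, s, .pa a⟩ => sng ⟨(θ : Matrix (Fin m) (Fin m) ℤ).mulVec r, s, .pa a⟩

/-- Linear extension of the twist to all of `W`. -/
def twL (θ : Matrix.GeneralLinearGroup (Fin m) ℤ) (w : W m n false) : W m n false :=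
  w.sum fun x c => c • twB θ x

/-- The embedding of (the basis of) `V_0 = W(m,n) ⋉ A d_0` into `W(m+1,n)` as the
zero component of the `ℤ`-grading by `ad(d_0)`-eigenvalues (index `0` plays the
role of `t_0`). -/
def embB : WBasis m n true → WBasis (m + 1) n false
  | ⟨r, s, .di i⟩ => ⟨Fin.cons 0 r, s, .di i.succ⟩
  | ⟨r, s, .pa a⟩ => ⟨Fin.cons 0 r, s, .pa a⟩
  | ⟨r, s, .d0⟩ => ⟨Fin.cons 0 r, s, .di 0⟩

end

end WSuper

namespace WSuper

noncomputable section

section Brackets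

variable {r n : ℕ}

/-- The exponent of the Grassmann monomial `1`. -/
abbrev gzero : GExp n := fun _ => false

lemma gdeg_gzero : gdeg (gzero : GExp n) = 0 := by simp [gdeg]

lemma mulSgn_gzero_left (q : GExp n) : mulSgn gzero q = 1 := by
  simp [mulSgn, invCount]

lemma xorE_gzero_left (q : GExp n) : xorE gzero q = q := by
  funext a; simp [xorE]

lemma xorE_gzero_right (q : GExp n) : xorE q gzero = q := by
  funext a; simp [xorE]

lemma derC_gzero (a : Fin n) : derC a gzero = 0 := by simp [derC]

lemma brB_di_di (α γ : LExp r) (q : GExp n) (i j : Fin r) :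
    brB (b := false) (α, gzero, .di i) (γ, q, .di j)
      = (γ i : ℂ) • sng (α + γ, q, .di j) - (α j : ℂ) • sng (α + γ, q, .di i) := by
  simp [brB, mulSgn_gzero_left, xorE_gzero_left]

lemma brB_di_pa (α γ : LExp r) (q : GExp n) (i : Fin r) (a : Fin n) :
    brB (b := false) (α, gzero, .di i) (γ, q, .pa a) = (γ i : ℂ) • sng (α + γ, q, .pa a) := by
  simp [brB, mulSgn_gzero_left, xorE_gzero_left, derC_gzero]

/-- The homogeneous component of degree `γ`. -/
def homog (r n : ℕ) (γ : LExp r) : Submodule ℂ (W r n false) :=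
  Submodule.span ℂ (Set.range fun z : GExp n × Dir r n false => sng (γ, z.1, z.2))

lemma sng_mem_homog (γ : LExp r) (s : GExp n) (D : Dir r n false) :
    sng (γ, s, D) ∈ homog r n γ :=
  Submodule.subset_span ⟨(s, D), rfl⟩

lemma brB_mem_homog (α β : LExp r) (s q : GExp n) (D D' : Dir r n false) :
    brB (b := false) (α, s, D) (β, q, D') ∈ homog r n (α + β) := by
  cases D <;> cases D' <;> simp only [brB] <;>
    exact Submodule.sub_mem _ (Submodule.smul_mem _ _ (sng_mem_homog _ _ _))
      (Submodule.smul_mem _ _ (sng_mem_homog _ _ _))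

end Brackets

section Action

variable {r n : ℕ} (ρ : WRep r n false)

/-- `v` is annihilated by the homogeneous component of degree `γ`. -/
def Kill (γ : LExp r) (v : ρ.M) : Prop := ∀ s D, ρ.g (γ, s, D) v = 0

/-- The action of `t^α d_w`, where `d_w = ∑ w_i d_i`. -/
def wittOp (α : LExp r) (w : Fin r → ℂ) : ρ.M →ₗ[ℂ] ρ.M :=
  ∑ i, w i • ρ.g (α, gzero, .di i)

/-- The pairing of `w` with an exponent. -/
def pair (w : Fin r → ℂ) (γ : LExp r) : ℂ := ∑ i, w i * (γ i : ℂ)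

lemma pair_add (w : Fin r → ℂ) (γ δ : LExp r) : pair w (γ + δ) = pair w γ + pair w δ := by
  simp [pair, mul_add, Finset.sum_add_distrib]

lemma pair_neg (w : Fin r → ℂ) (γ : LExp r) : pair w (-γ) = -pair w γ := by
  simp [pair]

lemma pair_sub (w : Fin r → ℂ) (γ δ : LExp r) : pair w (γ - δ) = pair w γ - pair w δ := by
  rw [sub_eq_add_neg, pair_add, pair_neg, sub_eq_add_neg]

lemma pair_zsmul (w : Fin r → ℂ) (k : ℤ) (γ : LExp r) : pair w (k • γ) = k * pair w γ := by
  simp only [pair, Pi.smul_apply, smul_eq_mul, Int.cast_mul, Finset.mul_sum]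
  exact Finset.sum_congr rfl fun i _ => by ring

lemma pair_single (i : Fin r) (γ : LExp r) : pair (Pi.single i 1) γ = γ i := by
  simp [pair, Pi.single_apply]

lemma pair_single_right (w : Fin r → ℂ) (i : Fin r) : pair w (Pi.single i 1) = w i := by
  simp [pair, Pi.single_apply]

variable {ρ}

lemma act_mem_of_mem_homog {P : Submodule ℂ ρ.M} {γ : LExp r} {v : ρ.M}
    (h : ∀ s D, ρ.g (γ, s, D) v ∈ P) {x : W r n false} (hx : x ∈ homog r n γ) :
    ρ.act x v ∈ P := by
  have : homog r n γ ≤ P.comap (ρ.act.flip v) := by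
    refine Submodule.span_le.2 ?_
    rintro _ ⟨z, rfl⟩
    exact h z.1 z.2
  exact this hx

lemma g_g_mem {P : Submodule ℂ ρ.M} {α β : LExp r} {s q : GExp n} {D D' : Dir r n false}
    {v : ρ.M} (h₁ : ρ.g (β, q, D') (ρ.g (α, s, D) v) ∈ P)
    (h₂ : ∀ s D, ρ.g (α + β, s, D) v ∈ P) :
    ρ.g (α, s, D) (ρ.g (β, q, D') v) ∈ P := by
  have h := LinearMap.congr_fun (ρ.super (α, s, D) (β, q, D')) v
  have h3 := act_mem_of_mem_homog h₂ (brB_mem_homog α β s q D D')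
  rw [h] at h3
  have := P.add_mem h3 (P.smul_mem ((-1 : ℂ) ^ (par (b := false) (α, s, D) *
    par (b := false) (β, q, D'))) h₁)
  simpa [WRep.g] using this

lemma even_bracket (α γ : LExp r) (i : Fin r) (q : GExp n) (D : Dir r n false) (v : ρ.M) :
    ρ.g (α, gzero, .di i) (ρ.g (γ, q, D) v) - ρ.g (γ, q, D) (ρ.g (α, gzero, .di i) v)
      = ρ.act (brB (b := false) (α, gzero, .di i) (γ, q, D)) v := by
  rw [ρ.super]
  simp [par, gdeg_gzero, WRep.g]

lemma wittOp_bracket_pa (α γ : LExp r) (w : Fin r → ℂ) (q : GExp n) (a : Fin n) (v : ρ.M) :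
    wittOp ρ α w (ρ.g (γ, q, .pa a) v) - ρ.g (γ, q, .pa a) (wittOp ρ α w v)
      = pair w γ • ρ.g (α + γ, q, .pa a) v := by
  simp only [wittOp, LinearMap.sum_apply, LinearMap.smul_apply, map_sum, map_smul,
    ← Finset.sum_sub_distrib, ← smul_sub, even_bracket, brB_di_pa, pair, Finset.sum_smul]
  exact Finset.sum_congr rfl fun i _ => by simp [WRep.g, mul_smul]

lemma wittOp_bracket_di (α γ : LExp r) (w : Fin r → ℂ) (q : GExp n) (j : Fin r) (v : ρ.M) :
    wittOp ρ α w (ρ.g (γ, q, .di j) v) - ρ.g (γ, q, .di j) (wittOp ρ α w v)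
      = pair w γ • ρ.g (α + γ, q, .di j) v
        - (α j : ℂ) • ∑ i, w i • ρ.g (α + γ, q, .di i) v := by
  simp only [wittOp, LinearMap.sum_apply, LinearMap.smul_apply, map_sum, map_smul,
    ← Finset.sum_sub_distrib, ← smul_sub, even_bracket, brB_di_di, pair, Finset.sum_smul,
    Finset.smul_sum]
  refine Finset.sum_congr rfl fun i _ => ?_
  simp only [WRep.g, map_sub, map_smul, LinearMap.sub_apply, LinearMap.smul_apply, smul_sub,
    mul_smul]
  rw [smul_comm (w i) (α j : ℂ)]

/-- If `t^α d_w` commutes with the degree `γ` component on `v`, then the degree `α + γ`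
component annihilates `v`, for `w` in general position. -/
lemma kill_of_wittOp {α γ : LExp r} {w : Fin r → ℂ} {v : ρ.M}
    (h₁ : ∀ s D, wittOp ρ α w (ρ.g (γ, s, D) v) = 0)
    (h₂ : ∀ s D, ρ.g (γ, s, D) (wittOp ρ α w v) = 0)
    (hγ : pair w γ ≠ 0) (hγα : pair w γ ≠ pair w α) : Kill ρ (α + γ) v := by
  intro s D
  cases D with
  | pa a =>
    have h := wittOp_bracket_pa α γ w s a v
    rw [h₁, h₂, sub_zero] at h
    exact (smul_eq_zero.1 h.symm).resolve_left hγ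
  | di j =>
    have h : ∀ j, pair w γ • ρ.g (α + γ, s, .di j) v
        = (α j : ℂ) • ∑ i, w i • ρ.g (α + γ, s, .di i) v := fun j => by
      have h := wittOp_bracket_di α γ w s j v
      rw [h₁, h₂, sub_zero] at h
      exact sub_eq_zero.1 h.symm
    have hs : (pair w γ - pair w α) • ∑ i, w i • ρ.g (α + γ, s, .di i) v = 0 := by
      rw [sub_smul, sub_eq_zero]
      conv_rhs => rw [pair, Finset.sum_smul]
      rw [Finset.smul_sum]
      refine Finset.sum_congr rfl fun i _ => ?_
      rw [smul_comm, h, mul_smul]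
    have hs0 := (smul_eq_zero.1 hs).resolve_left (sub_ne_zero.2 hγα)
    have hj := h j
    rw [hs0, smul_zero] at hj
    exact (smul_eq_zero.1 hj).resolve_left hγ

lemma wittOp_eq_zero {α : LExp r} (w : Fin r → ℂ) {v : ρ.M} (h : Kill ρ α v) :
    wittOp ρ α w v = 0 := by
  simp [wittOp, LinearMap.sum_apply, h _ _]

lemma exists_pair_ne {β δ : LExp r} (hβ : β ≠ 0) (hδ : δ ≠ 0) :
    ∃ w : Fin r → ℂ, pair w β ≠ 0 ∧ pair w δ ≠ 0 := by
  obtain ⟨i, hi⟩ := Function.ne_iff.1 hβ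
  obtain ⟨j, hj⟩ := Function.ne_iff.1 hδ
  have hi' : (β i : ℂ) ≠ 0 := by exact_mod_cast hi
  have hj' : (δ j : ℂ) ≠ 0 := by exact_mod_cast hj
  by_cases h1 : (δ i : ℂ) = 0
  · by_cases h2 : (β j : ℂ) = 0
    · refine ⟨Pi.single i 1 + Pi.single j 1, ?_, ?_⟩ <;>
        simp [pair, add_mul, Finset.sum_add_distrib, Pi.single_apply, h1, h2, hi', hj']
    · exact ⟨Pi.single j 1, by rwa [pair_single], by rwa [pair_single]⟩
  · exact ⟨Pi.single i 1, by rwa [pair_single], by rwa [pair_single]⟩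

lemma kill_add_of_comp {α β : LExp r} (hne : α ≠ β) {v : ρ.M}
    (h₁ : ∀ s D q D', ρ.g (α, s, D) (ρ.g (β, q, D') v) = 0)
    (h₂ : ∀ s D q D', ρ.g (β, q, D') (ρ.g (α, s, D) v) = 0) : Kill ρ (α + β) v := by
  have key : ∀ {α β : LExp r}, β ≠ 0 → α ≠ β →
      (∀ s D q D', ρ.g (α, s, D) (ρ.g (β, q, D') v) = 0) →
      (∀ s D q D', ρ.g (β, q, D') (ρ.g (α, s, D) v) = 0) → Kill ρ (α + β) v := by
    intro α β hβ hne h₁ h₂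
    obtain ⟨w, hw, hw'⟩ := exists_pair_ne hβ (sub_ne_zero.2 hne.symm)
    refine kill_of_wittOp (w := w) ?_ ?_ hw (sub_ne_zero.1 (by rwa [← pair_sub]))
    · intro s D; simp [wittOp, LinearMap.sum_apply, h₁]
    · intro s D; simp [wittOp, LinearMap.sum_apply, h₂]
  by_cases hβ : β = 0
  · have hα : α ≠ 0 := fun h => hne (h.trans hβ.symm)
    rw [add_comm]
    exact key hα hne.symm (fun s D q D' => h₂ q D' s D) (fun s D q D' => h₁ q D' s D)
  · exact key hβ hne h₁ h₂

lemma Kill.add {α β : LExp r} {v : ρ.M} (hα : Kill ρ α v) (hβ : Kill ρ β v) (hne : α ≠ β) :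
    Kill ρ (α + β) v :=
  kill_add_of_comp hne (fun s D q D' => by rw [hβ q D', map_zero])
    (fun s D q D' => by rw [hα s D, map_zero])

/-- A vector annihilated by `t^α d_w` with `α ∈ 2ℤ^r`, and by everything sufficiently far in the
direction `-α`, is annihilated by the whole algebra. -/
lemma kill_all_of_wittOp {α' : LExp r} (hα : α' ≠ 0) {w : Fin r → ℂ} (hw : w ≠ 0) {v : ρ.M}
    (hT : wittOp ρ ((2 : ℤ) • α') w v = 0)
    (hdeep : ∀ b : LExp r, ∃ J : ℕ, Kill ρ (b - (J : ℤ) • ((2 : ℤ) • α')) v) (b : LExp r) :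
    Kill ρ b v := by
  set α := (2 : ℤ) • α' with hαdef
  have hα0 : α ≠ 0 := smul_ne_zero two_ne_zero hα
  have good : ∀ b : LExp r, (∀ i : ℤ, pair w b ≠ i * pair w α) → Kill ρ b v := by
    intro b hb
    obtain ⟨J, hJ⟩ := hdeep b
    have : ∀ j : ℕ, Kill ρ (b - (J : ℤ) • α + (j : ℤ) • α) v := by
      intro j
      induction j with
      | zero => simpa using hJ
      | succ j ih =>
        have e : b - (J : ℤ) • α + ((j + 1 : ℕ) : ℤ) • α
            = α + (b - (J : ℤ) • α + (j : ℤ) • α) := by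
          push_cast; rw [add_smul, one_smul]; abel
        have e2 : pair w (b - (J : ℤ) • α + (j : ℤ) • α)
            = pair w b - (J - j : ℤ) * pair w α := by
          rw [pair_add, pair_sub, pair_zsmul w J α, pair_zsmul w j α]; push_cast; ring
        rw [e]
        refine kill_of_wittOp (w := w) (fun s D => by rw [ih s D, map_zero])
          (fun s D => by rw [hT, map_zero]) ?_ ?_
        · rw [e2, sub_ne_zero]; exact hb _
        · rw [e2]; intro h
          refine hb (J - j + 1) ?_
          push_cast at h ⊢
          linear_combination h
    simpa using this J
  obtain ⟨c, hc⟩ : ∃ c : LExp r, ∀ i : ℤ, pair w c ≠ i * pair w α := by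
    by_cases h0 : pair w α = 0
    · obtain ⟨i, hi⟩ := Function.ne_iff.1 hw
      exact ⟨Pi.single i 1, fun k => by rw [pair_single_right, h0, mul_zero]; exact hi⟩
    · refine ⟨α', fun k hk => ?_⟩
      rw [hαdef, pair_zsmul] at h0 hk
      have h1 : pair w α' ≠ 0 := right_ne_zero_of_mul h0
      have h2 : (1 : ℂ) = k * 2 := by
        apply mul_right_cancel₀ h1
        push_cast at hk
        linear_combination hk
      have h3 : (1 : ℤ) = k * 2 := by exact_mod_cast h2
      omega
  by_cases hb : ∀ i : ℤ, pair w b ≠ i * pair w α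
  · exact good b hb
  · push Not at hb
    obtain ⟨i, hi⟩ := hb
    have hsum : ∀ c : LExp r, (∀ i : ℤ, pair w c ≠ i * pair w α) → b - c ≠ c →
        Kill ρ b v := by
      intro c hc hne
      have h1 : Kill ρ (b - c) v := good _ fun k hk => hc (i - k) (by
        rw [pair_sub, hi] at hk; push_cast; linear_combination -hk)
      simpa using h1.add (good c hc) hne
    by_cases hne : b - c = c
    · refine hsum (c + α) (fun k hk => hc (k - 1) ?_) ?_
      · rw [pair_add] at hk; push_cast; linear_combination hk
      · intro h
        apply hα0
        have h1 : b - c = c + (2 : ℤ) • α := by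
          rw [two_smul, ← add_assoc, ← h]; abel
        rw [hne] at h1
        exact (smul_eq_zero.1 (left_eq_add.1 h1)).resolve_left two_ne_zero
    · exact hsum c hc hne

end Action

end

end WSuper

namespace WSuper

noncomputable section

section Weights

variable {r n : ℕ} (ρ : WRep r n false)

/-- The weight space of weight `lam + γ`. -/
def wt (lam : Fin r → ℂ) (γ : LExp r) : Submodule ℂ ρ.M :=
  wtG ρ.g (Sum.elim (fun i => lam i + γ i) fun j => j.elim0)

variable {ρ}

lemma mem_wtG {M : Type} [AddCommGroup M] [Module ℂ M] {F : GAct r n false M}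
    {mu : HIdx r false → ℂ} {v : M} :
    v ∈ wtG F mu ↔ ∀ i, F (0, gzero, .di i) v = mu (.inl i) • v := by
  simp only [wtG, Submodule.mem_iInf, LinearMap.mem_ker, LinearMap.sub_apply,
    LinearMap.smul_apply, LinearMap.id_apply, sub_eq_zero]
  exact ⟨fun h i => h (.inl i), fun h k => match k with
    | .inl i => h i
    | .inr j => j.elim0⟩

lemma mem_wt {lam : Fin r → ℂ} {γ : LExp r} {v : ρ.M} :
    v ∈ wt ρ lam γ ↔ ∀ i, ρ.g (0, gzero, .di i) v = (lam i + γ i) • v := by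
  simp [wt, mem_wtG]

lemma wtG_eq_wt (mu : HIdx r false → ℂ) : wtG ρ.g mu = wt ρ (fun i => mu (.inl i)) 0 := by
  ext v; simp [mem_wt, mem_wtG]

lemma cartan_g (i : Fin r) (α : LExp r) (s : GExp n) (D : Dir r n false) (v : ρ.M) :
    ρ.g (0, gzero, .di i) (ρ.g (α, s, D) v)
      = ρ.g (α, s, D) (ρ.g (0, gzero, .di i) v) + (α i : ℂ) • ρ.g (α, s, D) v := by
  rw [← sub_eq_iff_eq_add', even_bracket]
  cases D with
  | pa a => simp [brB_di_pa, WRep.g]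
  | di j => simp [brB_di_di, WRep.g]

lemma g_mem_wt {lam : Fin r → ℂ} {γ : LExp r} {v : ρ.M} (hv : v ∈ wt ρ lam γ) (α : LExp r)
    (s : GExp n) (D : Dir r n false) : ρ.g (α, s, D) v ∈ wt ρ lam (γ + α) := by
  rw [mem_wt] at hv ⊢
  intro i
  rw [cartan_g, hv, map_smul, ← add_smul]
  simp [add_assoc]

lemma wittOp_mem_wt {lam : Fin r → ℂ} {γ : LExp r} {v : ρ.M} (hv : v ∈ wt ρ lam γ) (α : LExp r)
    (w : Fin r → ℂ) : wittOp ρ α w v ∈ wt ρ lam (γ + α) := by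
  rw [wittOp, LinearMap.sum_apply]
  exact Submodule.sum_mem _ fun i _ => Submodule.smul_mem _ _ (g_mem_wt hv α _ _)

lemma eq_top_of_invariant (hs : IsSimpleG ρ.g) {N : Submodule ℂ ρ.M}
    (hN : ∀ γ s D, ∀ v ∈ N, ρ.g (γ, s, D) v ∈ N) {v : ρ.M} (hv : v ∈ N) (hv0 : v ≠ 0) :
    N = ⊤ :=
  (hs.2 N fun x v hv => hN x.1 x.2.1 x.2.2 v hv).resolve_left
    fun h => hv0 (by simpa [h] using hv)

lemma iSup_wt_eq_top (hs : IsSimpleG ρ.g) {lam : Fin r → ℂ} {γ : LExp r}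
    (h : wt ρ lam γ ≠ ⊥) : ⨆ γ, wt ρ lam γ = ⊤ := by
  obtain ⟨v, hv, hv0⟩ := Submodule.exists_mem_ne_zero_of_ne_bot h
  refine eq_top_of_invariant hs (fun α s D w hw => ?_) (Submodule.mem_iSup_of_mem γ hv) hv0
  have : (⨆ γ, wt ρ lam γ) ≤ (⨆ γ, wt ρ lam γ).comap (ρ.g (α, s, D)) :=
    iSup_le fun γ w hw => Submodule.mem_iSup_of_mem (γ + α) (g_mem_wt hw α s D)
  exact this hw

lemma exists_wt_ne_bot (hs : IsSimpleG ρ.g) (hH : IsStrongHCG ρ.g) :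
    ∃ lam : Fin r → ℂ, wt ρ lam 0 ≠ ⊥ := by
  by_contra! h
  obtain ⟨v, hv⟩ := hs.1
  have h1 : (⨆ mu, wtG ρ.g mu) = ⊥ := by simp [wtG_eq_wt, h]
  have : v ∈ (⊥ : Submodule ℂ ρ.M) := by rw [← h1, hH.1]; trivial
  exact hv (by simpa using this)

lemma wt_finiteDimensional (hH : IsStrongHCG ρ.g) (lam : Fin r → ℂ) (γ : LExp r) :
    FiniteDimensional ℂ (wt ρ lam γ) := hH.2 _

/-- All weights of a simple module lie in a single coset of the weight lattice. -/
lemma exists_eq_add_of_wtG_ne_bot {lam : Fin r → ℂ} (htop : ⨆ γ, wt ρ lam γ = ⊤)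
    {mu : HIdx r false → ℂ} (hmu : wtG ρ.g mu ≠ ⊥) :
    ∃ γ : LExp r, ∀ i, mu (.inl i) = lam i + γ i := by
  suffices h : ∀ i, ∃ k : ℤ, mu (.inl i) = lam i + k by
    choose k hk using h
    exact ⟨k, hk⟩
  intro i
  by_contra! hk
  obtain ⟨v, hv, hv0⟩ := Submodule.exists_mem_ne_zero_of_ne_bot hmu
  have hd := Module.End.eigenspaces_iSupIndep (ρ.g (0, gzero, .di i)) (mu (.inl i))
  refine hv0 (Submodule.disjoint_def.1 hd v ?_ ?_)
  · rw [Module.End.mem_eigenspace_iff]; exact mem_wtG.1 hv i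
  · have hle : (⨆ γ, wt ρ lam γ) ≤ ⨆ (j) (_ : j ≠ mu (.inl i)),
        Module.End.eigenspace (ρ.g (0, gzero, .di i)) j := by
      refine iSup_le fun γ => le_iSup₂_of_le (lam i + γ i) (hk _).symm fun w hw => ?_
      rw [Module.End.mem_eigenspace_iff]; exact mem_wt.1 hw i
    exact hle (by rw [htop]; trivial)

lemma exists_finrank_wt_gt (hH : IsStrongHCG ρ.g) (hnb : ¬ IsStronglyCuspidalG ρ.g)
    {lam : Fin r → ℂ} (htop : ⨆ γ, wt ρ lam γ = ⊤) (C : ℕ) :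
    ∃ γ, C < Module.finrank ℂ (wt ρ lam γ) := by
  by_contra! h
  refine hnb ⟨hH, C, fun mu => ?_⟩
  by_cases hmu : wtG ρ.g mu = ⊥
  · rw [hmu]; simp
  · obtain ⟨γ, hγ⟩ := exists_eq_add_of_wtG_ne_bot htop hmu
    have : wtG ρ.g mu = wt ρ lam γ := by ext v; simp [mem_wt, mem_wtG, hγ]
    rw [this]; exact h γ

/-- An invariant vector spans a simple module, which is then strongly cuspidal. -/
lemma eq_zero_of_kill_all (hs : IsSimpleG ρ.g) (hH : IsStrongHCG ρ.g)
    (hnb : ¬ IsStronglyCuspidalG ρ.g) {v : ρ.M} (hv : ∀ γ, Kill ρ γ v) : v = 0 := by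
  by_contra hv0
  have htop : Submodule.span ℂ {v} = ⊤ := by
    refine eq_top_of_invariant hs (fun γ s D w hw => ?_) (Submodule.mem_span_singleton_self v) hv0
    obtain ⟨c, rfl⟩ := Submodule.mem_span_singleton.1 hw
    simp [hv γ s D]
  have hfin : FiniteDimensional ℂ ρ.M :=
    ⟨⟨{v}, by simpa using htop⟩⟩
  refine hnb ⟨hH, 1, fun mu => (Submodule.finrank_le _).trans ?_⟩
  rw [← finrank_top, ← htop]
  exact finrank_span_singleton hv0 |>.le

/-- Dimension count for a finite family of graded maps. -/
lemma exists_common_kernel (hH : IsStrongHCG ρ.g) {lam : Fin r → ℂ} {γ : LExp r}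
    {ι : Type*} [Fintype ι] (f : ι → ρ.M →ₗ[ℂ] ρ.M) (δ : ι → LExp r)
    (hf : ∀ i, ∀ v ∈ wt ρ lam γ, f i v ∈ wt ρ lam (δ i))
    (hdim : ∑ i, Module.finrank ℂ (wt ρ lam (δ i)) < Module.finrank ℂ (wt ρ lam γ)) :
    ∃ v ∈ wt ρ lam γ, v ≠ 0 ∧ ∀ i, f i v = 0 := by
  have := fun γ => wt_finiteDimensional hH lam γ
  let F : wt ρ lam γ →ₗ[ℂ] ∀ i, wt ρ lam (δ i) := LinearMap.pi fun i => (f i).restrict (hf i)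
  have hker : LinearMap.ker F ≠ ⊥ := F.ker_ne_bot_of_finrank_lt (by
    rwa [Module.finrank_pi_fintype])
  obtain ⟨v, hv, hv0⟩ := Submodule.exists_mem_ne_zero_of_ne_bot hker
  refine ⟨v, v.2, by simpa using hv0, fun i => ?_⟩
  have := congrArg Subtype.val (congrFun (LinearMap.mem_ker.1 hv) i)
  simpa [F] using this

end Weights

section Cones

variable {r n : ℕ}

/-- The integral points of the cone around the direction `β`, moved by `c` into its interior. -/
def cone (β : LExp r) (c : ℤ) : Set (LExp r) := {γ | ∃ k : ℤ, ∀ i, |γ i - k * β i| ≤ k - c}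

lemma cone_anti (β : LExp r) {a b : ℤ} (h : a ≤ b) : cone β b ⊆ cone β a := by
  rintro γ ⟨k, hk⟩
  exact ⟨k, fun i => (hk i).trans (by omega)⟩

lemma add_mem_cone {β γ δ : LExp r} {a b : ℤ} (hγ : γ ∈ cone β a) (hδ : δ ∈ cone β b) :
    γ + δ ∈ cone β (a + b) := by
  obtain ⟨k, hk⟩ := hγ
  obtain ⟨l, hl⟩ := hδ
  refine ⟨k + l, fun i => ?_⟩
  have e : (γ + δ) i - (k + l) * β i = (γ i - k * β i) + (δ i - l * β i) := by
    simp only [Pi.add_apply]; ring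
  rw [e]
  exact (abs_add_le _ _).trans (by linarith [hk i, hl i])

lemma add_mem_cone_of_le {β γ α : LExp r} {a b : ℤ} (hγ : γ ∈ cone β (b + a))
    (hα : ∀ i, |α i| ≤ a) : γ + α ∈ cone β b := by
  obtain ⟨k, hk⟩ := hγ
  refine ⟨k, fun i => ?_⟩
  have e : (γ + α) i - k * β i = (γ i - k * β i) + α i := by
    simp only [Pi.add_apply]; ring
  rw [e]
  exact (abs_add_le _ _).trans (by linarith [hk i, hα i])

lemma exists_abs_le (α : LExp r) : ∃ a : ℤ, 0 ≤ a ∧ ∀ i, |α i| ≤ a :=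
  ⟨∑ i, |α i|, Finset.sum_nonneg fun _ _ => abs_nonneg _,
    fun i => Finset.single_le_sum (f := fun i => |α i|) (fun _ _ => abs_nonneg _)
      (Finset.mem_univ i)⟩

lemma add_nsmul_mem_cone {β γ κ : LExp r} {a : ℤ} (hγ : γ ∈ cone β a) (hκ : κ ∈ cone β 1)
    (j : ℕ) : γ + (j : ℤ) • κ ∈ cone β (a + j) := by
  induction j with
  | zero => simpa using hγ
  | succ j ih =>
    have := add_mem_cone ih hκ
    push_cast
    rw [add_smul, one_smul, ← add_assoc, ← add_assoc]
    exact this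

/-- Every translate is eventually absorbed by the cone. -/
lemma exists_add_nsmul_mem_cone (β : LExp r) {κ : LExp r} (hκ : κ ∈ cone β 1) (b : LExp r)
    (c : ℤ) : ∃ J : ℕ, ∀ j : ℕ, J ≤ j → b + (j : ℤ) • κ ∈ cone β c := by
  obtain ⟨a, ha0, ha⟩ := exists_abs_le b
  have h0 : (0 : LExp r) ∈ cone β 0 := ⟨0, fun i => by simp⟩
  refine ⟨(c + a).toNat, fun j hj => ?_⟩
  rw [add_comm]
  refine add_mem_cone_of_le (a := a) ?_ ha
  have := add_nsmul_mem_cone h0 hκ j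
  refine cone_anti β (b := 0 + (j : ℤ)) (by omega) ?_
  simpa using this

lemma zero_notMem_cone {β : LExp (r + 1)} (hβ : β ≠ 0) {c : ℤ} (hc : 1 ≤ c) :
    (0 : LExp (r + 1)) ∉ cone β c := by
  rintro ⟨k, hk⟩
  obtain ⟨i, hi⟩ := Function.ne_iff.1 hβ
  have h1 := hk i
  have h0 : 0 ≤ k - c := (abs_nonneg _).trans h1
  have h2 : 1 ≤ |β i| := Int.one_le_abs hi
  rw [Pi.zero_apply, zero_sub, abs_neg, abs_mul, abs_of_nonneg (by omega : (0 : ℤ) ≤ k)] at h1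
  nlinarith

lemma mem_cone_zero (γ : LExp r) (c : ℤ) : γ ∈ cone (0 : LExp r) c := by
  obtain ⟨a, ha0, ha⟩ := exists_abs_le γ
  exact ⟨a + c, fun i => by simpa using ha i⟩

/-- A box around `β` generates the cone around `β`. -/
lemma kill_cone_of_box {ρ : WRep (r + 1) n false} {β : LExp (r + 1)} {v : ρ.M}
    (h : ∀ b : LExp (r + 1), (∀ i, |b i| ≤ 2) → Kill ρ (β + b) v) :
    ∀ γ ∈ cone β 1, Kill ρ γ v := by
  have key : ∀ k : ℕ, ∀ δ : LExp (r + 1), (∀ i, |δ i| ≤ (k + 1 : ℕ)) →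
      Kill ρ (((k + 1 : ℕ) : ℤ) • β + δ) v := by
    intro k
    induction k with
    | zero =>
      intro δ hδ
      have := h δ fun i => (hδ i).trans (by norm_num)
      simpa using this
    | succ k ih =>
      intro δ hδ
      have step : ∀ b : LExp (r + 1), (∀ i, |b i| ≤ 2) → (∀ i, |(δ - b) i| ≤ (k + 1 : ℕ)) →
          ((k + 1 : ℕ) : ℤ) • β + (δ - b) ≠ β + b →
          Kill ρ (((k + 1 + 1 : ℕ) : ℤ) • β + δ) v := by
        intro b hb hδb hne
        have := (ih _ hδb).add (h b hb) hne
        have e : ((k + 1 + 1 : ℕ) : ℤ) • β + δ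
            = ((k + 1 : ℕ) : ℤ) • β + (δ - b) + (β + b) := by
          rw [Nat.cast_succ (k + 1), add_smul, one_smul]; abel
        rwa [e]
      set b : LExp (r + 1) := fun i => if 0 < δ i then 1 else if δ i < 0 then -1 else 0 with hb
      by_cases hne : ((k + 1 : ℕ) : ℤ) • β + (δ - b) = β + b
      · set η : ℤ := if 0 ≤ δ 0 then 1 else -1 with hη
        refine step (b + Pi.single 0 η) (fun i => ?_) (fun i => ?_) fun h' => ?_
        · by_cases hi : i = 0
          · subst hi
            simp only [Pi.add_apply, Pi.single_eq_same, hb, hη]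
            rw [abs_le]; split_ifs <;> omega
          · simp only [Pi.add_apply, Pi.single_eq_of_ne hi, hb]
            rw [abs_le]; split_ifs <;> omega
        · have hi' := hδ i
          rw [abs_le] at hi' ⊢
          push_cast at hi' ⊢
          by_cases hi : i = 0
          · subst hi
            simp only [Pi.add_apply, Pi.sub_apply, Pi.single_eq_same, hb, hη]
            split_ifs <;> omega
          · simp only [Pi.add_apply, Pi.sub_apply, Pi.single_eq_of_ne hi, hb]
            split_ifs <;> omega
        · have h0 := congrFun h' 0
          have h1 := congrFun hne 0
          simp only [Pi.add_apply, Pi.sub_apply, Pi.single_eq_same] at h0 h1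
          have : η ≠ 0 := by rw [hη]; split_ifs <;> omega
          omega
      · refine step b (fun i => ?_) (fun i => ?_) hne
        · simp only [hb]; rw [abs_le]; split_ifs <;> omega
        · have hi' := hδ i
          rw [abs_le] at hi' ⊢
          push_cast at hi' ⊢
          simp only [Pi.sub_apply, hb]
          split_ifs <;> omega
  rintro γ ⟨k, hk⟩
  have hk1 : 1 ≤ k := by have := (abs_nonneg _).trans (hk 0); omega
  obtain ⟨l, rfl⟩ : ∃ l : ℕ, k = (l + 1 : ℕ) := ⟨(k - 1).toNat, by omega⟩
  have := key l (γ - ((l + 1 : ℕ) : ℤ) • β) fun i => by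
    have := hk i
    simp only [Pi.sub_apply, Pi.smul_apply, smul_eq_mul]
    exact this.trans (by omega)
  simpa using this

/-- Being annihilated far out along a translation-stable family of sets propagates from one
vector to the whole simple module. -/
lemma forall_exists_kill {ρ : WRep r n false} (hs : IsSimpleG ρ.g) {F : ℤ → Set (LExp r)}
    (hanti : ∀ a b, a ≤ b → F b ⊆ F a)
    (hshift : ∀ α : LExp r, ∃ a : ℤ, 0 ≤ a ∧ ∀ c, ∀ γ ∈ F (c + a), γ + α ∈ F c)
    {v : ρ.M} (hv0 : v ≠ 0) (hv : ∃ c, ∀ γ ∈ F c, Kill ρ γ v) (u : ρ.M) :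
    ∃ c, ∀ γ ∈ F c, Kill ρ γ u := by
  let N : Submodule ℂ ρ.M :=
    { carrier := {w | ∃ c, ∀ γ ∈ F c, Kill ρ γ w}
      zero_mem' := ⟨0, fun γ _ s D => map_zero _⟩
      add_mem' := by
        rintro x y ⟨c, hc⟩ ⟨d, hd⟩
        refine ⟨max c d, fun γ hγ s D => ?_⟩
        rw [map_add, hc γ (hanti _ _ (le_max_left _ _) hγ), hd γ (hanti _ _ (le_max_right _ _) hγ),
          add_zero]
      smul_mem' := by
        rintro a x ⟨c, hc⟩
        exact ⟨c, fun γ hγ s D => by rw [map_smul, hc γ hγ, smul_zero]⟩ }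
  have htop : N = ⊤ := by
    refine eq_top_of_invariant hs (fun α s D w hw => ?_) (v := v) hv hv0
    obtain ⟨c, hc⟩ := hw
    obtain ⟨a, ha0, ha⟩ := hshift α
    refine ⟨c + a, fun γ hγ q D' => ?_⟩
    have := g_g_mem (P := (⊥ : Submodule ℂ ρ.M)) (α := γ) (β := α) (s := q) (D := D') (q := s)
      (D' := D) (v := w)
      (by rw [hc γ (hanti _ _ (by omega) hγ), map_zero]; exact Submodule.zero_mem _)
      (fun s D => by rw [hc _ (ha c γ hγ)]; exact Submodule.zero_mem _)
    simpa using this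
  have : u ∈ N := htop ▸ trivial
  exact this

end Cones

end

end WSuper

namespace WSuper

noncomputable section

section Support

variable {r n : ℕ} {ρ : WRep (r + 1) n false} {lam : Fin (r + 1) → ℂ}

/-- Some vector of an unbounded module is annihilated by a whole cone of degrees. -/
lemma exists_kill_cone (hs : IsSimpleG ρ.g) (hH : IsStrongHCG ρ.g)
    (hnb : ¬ IsStronglyCuspidalG ρ.g) (htop : ⨆ γ, wt ρ lam γ = ⊤) :
    ∃ (β : LExp (r + 1)) (v : ρ.M), β ≠ 0 ∧ v ≠ 0 ∧ ∀ γ ∈ cone β 1, Kill ρ γ v := by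
  let B : Finset (LExp (r + 1)) := Finset.Icc (fun _ => -2) (fun _ => 2)
  obtain ⟨μ, hμ⟩ := exists_finrank_wt_gt hH hnb htop
    (∑ z : B × GExp n × (Fin (r + 1) ⊕ Fin n), Module.finrank ℂ (wt ρ lam z.1))
  obtain ⟨v, -, hv0, hv⟩ := exists_common_kernel hH
    (fun z : B × GExp n × (Fin (r + 1) ⊕ Fin n) =>
      ρ.g ((z.1 : LExp (r + 1)) - μ, z.2.1, Sum.elim .di .pa z.2.2)) (fun z => z.1)
    (fun z v hv => by
      have := g_mem_wt hv ((z.1 : LExp (r + 1)) - μ) z.2.1 (Sum.elim .di .pa z.2.2)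
      rwa [add_sub_cancel] at this) hμ
  have hcone : ∀ γ ∈ cone (-μ) 1, Kill ρ γ v := by
    refine kill_cone_of_box fun b hb s D => ?_
    have hbB : b ∈ B := Finset.mem_Icc.2
      ⟨fun i => (abs_le.1 (hb i)).1, fun i => (abs_le.1 (hb i)).2⟩
    rw [neg_add_eq_sub]
    cases D with
    | di i => exact hv ⟨⟨b, hbB⟩, s, .inl i⟩
    | pa a => exact hv ⟨⟨b, hbB⟩, s, .inr a⟩
  refine ⟨-μ, v, fun h0 => hv0 ?_, hv0, hcone⟩
  rw [h0] at hcone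
  exact eq_zero_of_kill_all hs hH hnb fun γ => hcone γ (mem_cone_zero γ 1)

lemma forall_exists_kill_cone (hs : IsSimpleG ρ.g) {β : LExp (r + 1)} {v : ρ.M} (hv0 : v ≠ 0)
    {c : ℤ} (hv : ∀ γ ∈ cone β c, Kill ρ γ v) (u : ρ.M) : ∃ c, ∀ γ ∈ cone β c, Kill ρ γ u :=
  forall_exists_kill hs (fun _ _ h => cone_anti β h)
    (fun α => by
      obtain ⟨a, ha0, ha⟩ := exists_abs_le α
      exact ⟨a, ha0, fun c γ hγ => add_mem_cone_of_le hγ ha⟩) hv0 ⟨c, hv⟩ u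

/-- A finite-dimensional space of vectors is annihilated by a common cone. -/
lemma exists_forall_kill_cone {β : LExp (r + 1)}
    (hall : ∀ u : ρ.M, ∃ c, ∀ γ ∈ cone β c, Kill ρ γ u) (P : Submodule ℂ ρ.M)
    [FiniteDimensional ℂ P] : ∃ N : ℕ, 1 ≤ N ∧ ∀ γ ∈ cone β N, ∀ u ∈ P, Kill ρ γ u := by
  obtain ⟨S, rfl⟩ := (Submodule.fg_top P).1 (Module.Finite.fg_top)
  choose c hc using hall
  obtain ⟨C, hC⟩ := (S.image c).exists_le
  refine ⟨C.toNat + 1, by omega, fun γ hγ u hu s D => ?_⟩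
  have : Submodule.span ℂ (S : Set ρ.M) ≤ LinearMap.ker (ρ.g (γ, s, D)) := by
    refine Submodule.span_le.2 fun w hw => hc w γ (cone_anti β ?_ hγ) s D
    have := hC (c w) (Finset.mem_image_of_mem c hw)
    push_cast; omega
  exact this hu

/-- The support of an unbounded module avoids a translated cone at every point. -/
lemma wt_add_eq_bot (hs : IsSimpleG ρ.g) (hH : IsStrongHCG ρ.g)
    (hnb : ¬ IsStronglyCuspidalG ρ.g) {β : LExp (r + 1)} (hβ : β ≠ 0)
    (hall : ∀ u : ρ.M, ∃ c, ∀ γ ∈ cone β c, Kill ρ γ u) {μ : LExp (r + 1)} {N : ℕ} (hN : 1 ≤ N)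
    (h : ∀ γ ∈ cone β N, ∀ u ∈ wt ρ lam μ, Kill ρ γ u) {κ : LExp (r + 1)}
    (hκ : κ ∈ cone β (N + 2)) : wt ρ lam (μ + κ) = ⊥ := by
  refine (Submodule.eq_bot_iff _).2 fun u hu => ?_
  have hκ1 : κ ∈ cone β 1 := cone_anti β (by omega) hκ
  have desc : ∀ b : LExp (r + 1), b + κ ∈ cone β N → Kill ρ b u := by
    intro b hb
    obtain ⟨c, hc⟩ := hall u
    obtain ⟨J, hJ⟩ := exists_add_nsmul_mem_cone β hκ1 b c
    have step : ∀ j : ℕ, Kill ρ (b + ((j + 1 : ℕ) : ℤ) • κ) u → Kill ρ (b + (j : ℤ) • κ) u := by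
      intro j hj
      have ha : b + ((j + 1 : ℕ) : ℤ) • κ ∈ cone β N := by
        have := add_nsmul_mem_cone hb hκ1 j
        refine cone_anti β (show (N : ℤ) ≤ N + j by omega) ?_
        convert this using 1
        rw [Nat.cast_succ, add_smul, one_smul]; abel
      have e : b + (j : ℤ) • κ = b + ((j + 1 : ℕ) : ℤ) • κ + -κ := by
        rw [Nat.cast_succ, add_smul, one_smul]; abel
      rw [e]
      refine kill_add_of_comp (fun heq => ?_) (fun s D q D' => ?_) fun s D q D' => ?_
      · have h2 := add_mem_cone ha hκ1
        rw [heq, neg_add_cancel] at h2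
        exact zero_notMem_cone hβ (by omega) h2
      · refine h _ ha _ ?_ s D
        have := g_mem_wt hu (-κ) q D'
        rwa [add_neg_cancel_right] at this
      · rw [hj, map_zero]
    have all : ∀ i j : ℕ, Kill ρ (b + ((i + j : ℕ) : ℤ) • κ) u → Kill ρ (b + (i : ℤ) • κ) u := by
      intro i j
      induction j with
      | zero => exact id
      | succ j ih => exact fun hj => ih (step _ hj)
    have := all 0 J (by rw [zero_add]; exact hc _ (hJ J le_rfl))
    simpa using this
  refine eq_zero_of_kill_all hs hH hnb fun γ => ?_
  refine kill_cone_of_box (β := 0) (fun b hb => desc _ ?_) γ (mem_cone_zero γ 1)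
  rw [zero_add, add_comm b κ]
  exact add_mem_cone_of_le hκ hb

end Support

end

end WSuper

namespace WSuper

noncomputable section

section Separation

variable {r : ℕ}

/-- The real vector of an integral one. -/
def toReal (r : ℕ) : LExp r →+ (Fin r → ℝ) where
  toFun γ i := γ i
  map_zero' := by ext; simp
  map_add' _ _ := by ext; simp

lemma toReal_apply (γ : LExp r) (i : Fin r) : toReal r γ i = γ i := rfl

/-- The real open cone around `b`. -/
def openCone (b : Fin r → ℝ) : Set (Fin r → ℝ) := {x | ∃ t : ℝ, 0 < t ∧ ‖x - t • b‖ < t}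

lemma isOpen_openCone (b : Fin r → ℝ) : IsOpen (openCone b) := by
  have : openCone b = ⋃ (t : ℝ) (_ : 0 < t), Metric.ball (t • b) t := by
    ext x; simp [openCone, dist_eq_norm]
  rw [this]
  exact isOpen_iUnion fun t => isOpen_iUnion fun _ => Metric.isOpen_ball

lemma convex_openCone (b : Fin r → ℝ) : Convex ℝ (openCone b) := by
  rintro x ⟨t, ht, hx⟩ y ⟨s, hs, hy⟩ p q hp hq hpq
  refine ⟨p * t + q * s, ?_, ?_⟩
  · rcases hp.eq_or_lt with rfl | hp
    · have : q = 1 := by linarith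
      simp [this, hs]
    · have := mul_pos hp ht
      have := mul_nonneg hq hs.le
      linarith
  · have e : p • x + q • y - (p * t + q * s) • b = p • (x - t • b) + q • (y - s • b) := by
      simp only [smul_sub, add_smul, smul_smul]; abel
    rw [e]
    refine (norm_add_le _ _).trans_lt ?_
    rw [norm_smul, norm_smul, Real.norm_of_nonneg hp, Real.norm_of_nonneg hq]
    rcases hp.eq_or_lt with rfl | hp
    · have : q = 1 := by linarith
      simpa [this] using hy
    · have := mul_lt_mul_of_pos_left hx hp
      have := mul_le_mul_of_nonneg_left hy.le hq
      linarith

lemma smul_mem_openCone {b x : Fin r → ℝ} (hx : x ∈ openCone b) {c : ℝ} (hc : 0 < c) :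
    c • x ∈ openCone b := by
  obtain ⟨t, ht, h⟩ := hx
  refine ⟨c * t, mul_pos hc ht, ?_⟩
  rw [mul_smul, ← smul_sub, norm_smul, Real.norm_of_nonneg hc.le]
  exact mul_lt_mul_of_pos_left h hc

/-- The asymptotic directions of a set of integral vectors. -/
def asymp (A : Set (LExp r)) : Set (Fin r → ℝ) :=
  {x | ∃ E : ℝ, ∀ N : ℕ, ∃ α ∈ A, ‖toReal r α - (N : ℝ) • x‖ ≤ E}

lemma convex_asymp {A : Set (LExp r)} (hA : ∀ α ∈ A, ∀ β ∈ A, α + β ∈ A) :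
    Convex ℝ (asymp A) := by
  rintro x ⟨E, hE⟩ y ⟨E', hE'⟩ p q hp hq -
  refine ⟨E + ‖x‖ + (E' + ‖y‖), fun N => ?_⟩
  have key : ∀ (z : Fin r → ℝ) (c : ℝ) (α : LExp r) (E : ℝ), 0 ≤ c →
      ‖toReal r α - (⌊N * c⌋₊ : ℝ) • z‖ ≤ E → ‖toReal r α - ((N : ℝ) * c) • z‖ ≤ E + ‖z‖ := by
    intro z c α E hc h
    have e : toReal r α - ((N : ℝ) * c) • z
        = (toReal r α - (⌊N * c⌋₊ : ℝ) • z) + ((⌊N * c⌋₊ : ℝ) - N * c) • z := by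
      rw [sub_smul]; abel
    rw [e]
    refine (norm_add_le _ _).trans (add_le_add h ?_)
    rw [norm_smul, Real.norm_eq_abs]
    have h0 : (0 : ℝ) ≤ N * c := by positivity
    have h1 := Nat.floor_le h0
    have h2 := (Nat.lt_floor_add_one ((N : ℝ) * c))
    have : |(⌊N * c⌋₊ : ℝ) - N * c| ≤ 1 := by rw [abs_le]; constructor <;> linarith
    nlinarith [norm_nonneg z]
  obtain ⟨α, hα, h⟩ := hE ⌊N * p⌋₊
  obtain ⟨β, hβ, h'⟩ := hE' ⌊N * q⌋₊
  refine ⟨α + β, hA α hα β hβ, ?_⟩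
  have e : toReal r (α + β) - (N : ℝ) • (p • x + q • y)
      = (toReal r α - ((N : ℝ) * p) • x) + (toReal r β - ((N : ℝ) * q) • y) := by
    rw [map_add, smul_add, smul_smul, smul_smul]; abel
  rw [e]
  exact (norm_add_le _ _).trans (add_le_add (key x p α E hp h) (key y q β E' hq h'))

lemma toReal_mem_asymp {A : Set (LExp r)} (h0 : (0 : LExp r) ∈ A)
    (hA : ∀ α ∈ A, ∀ β ∈ A, α + β ∈ A) {α : LExp r} (hα : α ∈ A) :
    toReal r α ∈ asymp A := by
  refine ⟨0, fun N => ⟨N • α, ?_, ?_⟩⟩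
  · induction N with
    | zero => simpa using h0
    | succ N ih => rw [succ_nsmul]; exact hA _ ih _ hα
  · rw [map_nsmul]
    simp [← Nat.cast_smul_eq_nsmul ℝ]

/-- An asymptotic direction inside the open cone comes from an integral vector deep inside. -/
lemma exists_mem_cone_of_asymp {A : Set (LExp r)} {β : LExp r} {x : Fin r → ℝ}
    (hx : x ∈ asymp A) (hx' : x ∈ openCone (toReal r β)) : ∃ α ∈ A, α ∈ cone β 1 := by
  obtain ⟨E, hE⟩ := hx
  obtain ⟨t, ht, hxt⟩ := hx'
  obtain ⟨N, hN⟩ := exists_nat_gt ((E + ‖toReal r β‖ + 2) / (t - ‖x - t • toReal r β‖))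
  rw [div_lt_iff₀ (by linarith)] at hN
  obtain ⟨α, hα, hαE⟩ := hE N
  refine ⟨α, hα, ⌊N * t⌋, fun i => ?_⟩
  have h1 : (⌊N * t⌋ : ℝ) ≤ N * t := Int.floor_le _
  have h2 : (N * t : ℝ) < ⌊N * t⌋ + 1 := Int.lt_floor_add_one _
  set k : ℤ := ⌊N * t⌋
  have e : toReal r α - (k : ℝ) • toReal r β = (toReal r α - (N : ℝ) • x)
      + (N : ℝ) • (x - t • toReal r β) + (N * t - k) • toReal r β := by
    rw [smul_sub, sub_smul, smul_smul]; abel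
  have h3 : ‖toReal r α - (k : ℝ) • toReal r β‖
      ≤ E + N * ‖x - t • toReal r β‖ + ‖toReal r β‖ := by
    rw [e]
    refine (norm_add₃_le).trans ?_
    rw [norm_smul, norm_smul, Real.norm_eq_abs, Real.norm_eq_abs, Nat.abs_cast,
      abs_of_nonneg (by linarith)]
    have := mul_le_mul_of_nonneg_right (show N * t - k ≤ 1 by linarith) (norm_nonneg (toReal r β))
    linarith
  have h4 := (norm_le_pi_norm (toReal r α - (k : ℝ) • toReal r β) i).trans h3
  have h5 : ((|α i - k * β i| : ℤ) : ℝ) ≤ ((k - 1 : ℤ) : ℝ) := by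
    rw [Real.norm_eq_abs] at h4
    simp only [Pi.sub_apply, Pi.smul_apply, toReal_apply, smul_eq_mul] at h4
    push_cast
    linarith
  exact_mod_cast h5

lemma toReal_mem_openCone {β γ : LExp r} (hr : 0 < r) (hγ : γ ∈ cone β 1) :
    toReal r γ ∈ openCone (toReal r β) := by
  obtain ⟨k, hk⟩ := hγ
  have hk0 : (0 : ℝ) < k := by
    have := (abs_nonneg _).trans (hk ⟨0, hr⟩)
    exact_mod_cast (show 0 < k by omega)
  refine ⟨k, hk0, (pi_norm_lt_iff hk0).2 fun i => ?_⟩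
  have h : |γ i - k * β i| < k := (hk i).trans_lt (by omega)
  rw [Real.norm_eq_abs]
  simp only [Pi.sub_apply, Pi.smul_apply, toReal_apply, smul_eq_mul]
  exact_mod_cast h

/-- A linear functional separating the translations that preserve `S` from a cone that leads
out of `S`. -/
lemma exists_separating {S : Set (LExp (r + 1))} {β μ₀ : LExp (r + 1)} (hμ₀ : μ₀ ∈ S) {N : ℕ}
    (hS : ∀ κ ∈ cone β N, μ₀ + κ ∉ S) :
    ∃ φ : LExp (r + 1) →+ ℝ, (∀ γ ∈ cone β 1, φ γ < 0) ∧
      ∀ α : LExp (r + 1), (∀ μ ∈ S, μ + α ∈ S) → 0 ≤ φ α := by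
  set A : Set (LExp (r + 1)) := {α | ∀ μ ∈ S, μ + α ∈ S} with hAdef
  have h0 : (0 : LExp (r + 1)) ∈ A := fun μ hμ => by simpa using hμ
  have hA : ∀ α ∈ A, ∀ β ∈ A, α + β ∈ A := fun α hα β hβ μ hμ => by
    rw [← add_assoc]; exact hβ _ (hα _ hμ)
  have hdisj : Disjoint (openCone (toReal (r + 1) β)) (asymp A) := by
    refine Set.disjoint_left.2 fun x hx hx' => ?_
    obtain ⟨α, hα, hαc⟩ := exists_mem_cone_of_asymp hx' hx
    have hmul : ∀ j : ℕ, (j : ℤ) • α ∈ A := by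
      intro j
      induction j with
      | zero => simpa using h0
      | succ j ih => rw [Nat.cast_succ, add_smul, one_smul]; exact hA _ ih _ hα
    have h1 := add_nsmul_mem_cone (β := β) (γ := 0) (a := 0) ⟨0, fun i => by simp⟩ hαc N
    rw [zero_add, zero_add] at h1
    exact hS _ h1 (hmul N μ₀ hμ₀)
  obtain ⟨f, u, hf, hu⟩ := geometric_hahn_banach_open (convex_openCone (toReal (r + 1) β))
    (isOpen_openCone _) (convex_asymp hA) hdisj
  have hu0 : u ≤ 0 := by
    have := hu _ (toReal_mem_asymp h0 hA h0)
    simpa using this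
  have hu1 : 0 ≤ u := by
    by_contra! hneg
    have hβ : toReal (r + 1) β ∈ openCone (toReal (r + 1) β) := ⟨1, one_pos, by simp⟩
    have h1 := hf _ hβ
    have h2 : 0 < u / (2 * f (toReal (r + 1) β)) :=
      div_pos_of_neg_of_neg hneg (by linarith)
    have h3 := hf _ (smul_mem_openCone hβ h2)
    rw [map_smul, smul_eq_mul] at h3
    have : f (toReal (r + 1) β) ≠ 0 := by linarith
    field_simp at h3
    linarith
  refine ⟨(f : (Fin (r + 1) → ℝ) →ₗ[ℝ] ℝ).toAddMonoidHom.comp (toReal (r + 1)),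
    fun γ hγ => ?_, fun α hα => ?_⟩
  · exact (hf _ (toReal_mem_openCone (Nat.succ_pos r) hγ)).trans_le hu0
  · exact hu1.trans (hu _ (toReal_mem_asymp h0 hA hα))

end Separation

end

end WSuper

namespace WSuper

noncomputable section

section Growth

variable {r n : ℕ} {ρ : WRep (r + 1) n false} {lam : Fin (r + 1) → ℂ}

lemma single_ne_zero' (i : Fin (r + 1)) : (Pi.single i 1 : Fin (r + 1) → ℂ) ≠ 0 := by
  simp

lemma kill_of_wt_eq_bot {μ γ : LExp (r + 1)} {v : ρ.M} (hv : v ∈ wt ρ lam μ)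
    (h : wt ρ lam (μ + γ) = ⊥) : Kill ρ γ v := fun s D => by
  have := g_mem_wt hv γ s D
  rw [h] at this
  simpa using this

/-- No nonzero vector is annihilated by a degree in `2ℤ^r` on which the separating functional is
positive. -/
lemma not_kill_of_pos (hs : IsSimpleG ρ.g) (hH : IsStrongHCG ρ.g)
    (hnb : ¬ IsStronglyCuspidalG ρ.g) {β : LExp (r + 1)}
    (hall : ∀ u : ρ.M, ∃ c, ∀ γ ∈ cone β c, Kill ρ γ u) {φ : LExp (r + 1) →+ ℝ}
    (hneg : ∀ γ ∈ cone β 1, φ γ < 0)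
    (hpos : ∀ α, (∀ μ, wt ρ lam μ ≠ ⊥ → wt ρ lam (μ + α) ≠ ⊥) → 0 ≤ φ α)
    {α' : LExp (r + 1)} (hα' : 0 < φ α') {v : ρ.M} (hv0 : v ≠ 0) :
    ¬ Kill ρ ((2 : ℤ) • α') v := by
  intro hkill
  set α := (2 : ℤ) • α' with hα
  have hφα : 0 < φ α := by rw [hα, map_zsmul]; simpa using hα'
  have hα0 : α' ≠ 0 := by rintro rfl; simp at hα'
  by_cases hex : ∃ j : ℕ, -((j : ℤ) • α) ∈ cone β 1
  · obtain ⟨j, hj⟩ := hex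
    refine hv0 (eq_zero_of_kill_all hs hH hnb (kill_all_of_wittOp hα0 (single_ne_zero' 0)
      (wittOp_eq_zero _ hkill) fun b => ?_))
    obtain ⟨c, hc⟩ := hall v
    obtain ⟨i, hi⟩ := exists_add_nsmul_mem_cone β hj b c
    refine ⟨i * j, ?_⟩
    have := hc _ (hi i le_rfl)
    rwa [smul_neg, smul_smul, ← sub_eq_add_neg, ← Nat.cast_mul] at this
  · push Not at hex
    obtain ⟨c, hc⟩ := hall v
    let F : ℤ → Set (LExp (r + 1)) := fun c => {δ | ∃ γ ∈ cone β c, ∃ j : ℕ, δ = γ + (j : ℤ) • α}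
    have hF : ∃ c, ∀ γ ∈ F c, Kill ρ γ v := by
      refine ⟨max c 1, ?_⟩
      rintro _ ⟨γ, hγ, j, rfl⟩
      have hγc := cone_anti β (le_max_left c 1) hγ
      have hγ1 := cone_anti β (le_max_right c 1) hγ
      induction j with
      | zero => simpa using hc γ hγc
      | succ j ih =>
        have e : γ + ((j + 1 : ℕ) : ℤ) • α = γ + (j : ℤ) • α + α := by
          rw [Nat.cast_succ, add_smul, one_smul, add_assoc]
        rw [e]
        refine ih.add hkill fun heq => ?_
        cases j with
        | zero =>
          have h1 : γ = α := by simpa using heq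
          have := hneg γ hγ1
          rw [h1] at this
          exact lt_asymm this hφα
        | succ j =>
          refine hex j ?_
          have : -((j : ℤ) • α) = γ := by
            rw [Nat.cast_succ, add_smul, one_smul, ← add_assoc, add_eq_right] at heq
            exact (eq_neg_of_add_eq_zero_left heq).symm
          rwa [this]
    have hF' := forall_exists_kill hs (F := F)
      (fun a b h => by
        rintro _ ⟨γ, hγ, j, rfl⟩
        exact ⟨γ, cone_anti β h hγ, j, rfl⟩)
      (fun δ => by
        obtain ⟨a, ha0, ha⟩ := exists_abs_le δ
        refine ⟨a, ha0, ?_⟩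
        rintro c _ ⟨γ, hγ, j, rfl⟩
        exact ⟨γ + δ, add_mem_cone_of_le hγ ha, j, by abel⟩) hv0 hF
    obtain ⟨L, hL⟩ := exists_nat_gt (-φ β / φ α)
    rw [div_lt_iff₀ hφα] at hL
    set η := β + (L : ℤ) • α with hη
    have hφη : 0 < φ η := by
      rw [hη, map_add, map_zsmul, zsmul_eq_mul]
      push_cast
      linarith
    have hη0 : -η ≠ 0 := by
      intro h
      rw [neg_eq_zero.1 h, map_zero] at hφη
      exact lt_irrefl _ hφη
    obtain ⟨μ, hμ, hμ'⟩ : ∃ μ, wt ρ lam μ ≠ ⊥ ∧ wt ρ lam (μ + (2 : ℤ) • -η) = ⊥ := by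
      by_contra! h
      have := hpos _ h
      rw [map_zsmul, map_neg, zsmul_eq_mul] at this
      push_cast at this
      linarith
    obtain ⟨u, hu, hu0⟩ := Submodule.exists_mem_ne_zero_of_ne_bot hμ
    refine hu0 (eq_zero_of_kill_all hs hH hnb (kill_all_of_wittOp hη0 (single_ne_zero' 0)
      (wittOp_eq_zero _ (kill_of_wt_eq_bot hu hμ')) fun b => ?_))
    obtain ⟨c, hc⟩ := hF' u
    obtain ⟨J, hJ⟩ := exists_add_nsmul_mem_cone β
      (show β ∈ cone β 1 from ⟨1, fun i => by simp⟩) b c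
    refine ⟨J, hc _ ⟨_, hJ (J * 2) (by omega), J * 2 * L, ?_⟩⟩
    ext i
    simp only [hη, Pi.add_apply, Pi.sub_apply, Pi.smul_apply, Pi.neg_apply, smul_eq_mul]
    push_cast
    ring

lemma wt_add_ne_bot_of_not_kill {α μ : LExp (r + 1)}
    (h : ∀ v : ρ.M, v ≠ 0 → ¬ Kill ρ α v) (hμ : wt ρ lam μ ≠ ⊥) : wt ρ lam (μ + α) ≠ ⊥ := by
  obtain ⟨v, hv, hv0⟩ := Submodule.exists_mem_ne_zero_of_ne_bot hμ
  exact fun hbot => h v hv0 (kill_of_wt_eq_bot hv hbot)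

/-- The remainder modulo two, as an element of the unit cube. -/
lemma exists_cube_add_two_smul (δ : LExp r) :
    ∃ p ∈ Finset.Icc (0 : LExp r) 1, ∃ δ' : LExp r, δ = p + (2 : ℤ) • δ' :=
  ⟨fun i => δ i % 2, Finset.mem_Icc.2 ⟨fun i => by simp only [Pi.zero_apply]; omega,
    fun i => by simp only [Pi.one_apply]; omega⟩, fun i => δ i / 2, by
      ext i; simp only [Pi.add_apply, Pi.smul_apply, smul_eq_mul]; omega⟩

lemma exists_le_of_support {S : Set (LExp r)} {φ : LExp r →+ ℝ}
    (hadd : ∀ α', 0 < φ α' → ∀ μ ∈ S, μ + (2 : ℤ) • α' ∈ S) {μ₀ : LExp r}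
    (hcube : ∀ p ∈ Finset.Icc (0 : LExp r) 1, μ₀ + p ∉ S) : ∃ c : ℝ, ∀ μ ∈ S, c ≤ φ μ := by
  obtain ⟨M, hM⟩ := ((Finset.Icc (0 : LExp r) 1).image fun p => -φ (μ₀ + p)).exists_le
  refine ⟨-M, fun μ hμ => ?_⟩
  obtain ⟨p, hp, δ, hδ⟩ := exists_cube_add_two_smul (μ - μ₀)
  have e : μ₀ + p = μ + (2 : ℤ) • -δ := by
    rw [smul_neg, eq_add_neg_iff_add_eq, add_assoc, ← hδ]; abel
  have h1 : φ (-δ) ≤ 0 := by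
    by_contra! hpos
    exact hcube p hp (e ▸ hadd _ hpos μ hμ)
  have h2 := hM _ (Finset.mem_image_of_mem (fun p => -φ (μ₀ + p)) hp)
  rw [e, map_add, map_zsmul, zsmul_eq_mul] at h2
  push_cast at h2
  linarith

/-- On a module with support bounded below, the operators `t^α d_w` are injective. -/
lemma eq_zero_of_wittOp_eq_zero (hs : IsSimpleG ρ.g) (hH : IsStrongHCG ρ.g)
    (hnb : ¬ IsStronglyCuspidalG ρ.g) {φ : LExp (r + 1) →+ ℝ} {c : ℝ}
    (hlow : ∀ μ, wt ρ lam μ ≠ ⊥ → c ≤ φ μ) {α' : LExp (r + 1)} (hα' : 0 < φ α')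
    {w : Fin (r + 1) → ℂ} (hw : w ≠ 0) {μ : LExp (r + 1)} {v : ρ.M} (hv : v ∈ wt ρ lam μ)
    (h : wittOp ρ ((2 : ℤ) • α') w v = 0) : v = 0 := by
  have hα0 : α' ≠ 0 := by rintro rfl; simp at hα'
  refine eq_zero_of_kill_all hs hH hnb (kill_all_of_wittOp hα0 hw h fun b => ?_)
  obtain ⟨J, hJ⟩ := exists_nat_gt ((φ μ + φ b - c) / (2 * φ α'))
  rw [div_lt_iff₀ (by linarith)] at hJ
  refine ⟨J, kill_of_wt_eq_bot hv ?_⟩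
  by_contra hne
  have := hlow _ hne
  rw [map_add, map_sub, map_zsmul, map_zsmul, zsmul_eq_mul, zsmul_eq_mul] at this
  push_cast at this
  linarith

lemma finrank_wt_le (hs : IsSimpleG ρ.g) (hH : IsStrongHCG ρ.g)
    (hnb : ¬ IsStronglyCuspidalG ρ.g) {φ : LExp (r + 1) →+ ℝ} {c : ℝ}
    (hlow : ∀ μ, wt ρ lam μ ≠ ⊥ → c ≤ φ μ) {α' : LExp (r + 1)} (hα' : 0 < φ α')
    (μ : LExp (r + 1)) :
    Module.finrank ℂ (wt ρ lam μ) ≤ Module.finrank ℂ (wt ρ lam (μ + (2 : ℤ) • α')) := by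
  have := fun γ => wt_finiteDimensional hH lam γ
  refine LinearMap.finrank_le_finrank_of_injective
    (f := (wittOp ρ ((2 : ℤ) • α') (Pi.single 0 1)).restrict fun v hv => wittOp_mem_wt hv _ _) ?_
  refine (injective_iff_map_eq_zero _).2 fun v hv => Subtype.ext ?_
  exact eq_zero_of_wittOp_eq_zero hs hH hnb hlow hα' (single_ne_zero' 0) v.2
    (by simpa using congrArg Subtype.val hv)

lemma wittOp_sub_smul (α : LExp r) {ρ : WRep r n false} (w w' : Fin r → ℂ) (κ : ℂ) (v : ρ.M) :
    wittOp ρ α (w - κ • w') v = wittOp ρ α w v - κ • wittOp ρ α w' v := by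
  simp [wittOp, sub_smul, Finset.sum_sub_distrib, mul_smul, Finset.smul_sum]

lemma finrank_wt_lt (hs : IsSimpleG ρ.g) (hH : IsStrongHCG ρ.g)
    (hnb : ¬ IsStronglyCuspidalG ρ.g) {φ : LExp (r + 1) →+ ℝ} {c : ℝ}
    (hlow : ∀ μ, wt ρ lam μ ≠ ⊥ → c ≤ φ μ) {α' : LExp (r + 1)} (hα' : 0 < φ α')
    {i : Fin (r + 1)} (hi : i ≠ 0) {μ : LExp (r + 1)} (hμ : wt ρ lam μ ≠ ⊥) :
    Module.finrank ℂ (wt ρ lam μ) < Module.finrank ℂ (wt ρ lam (μ + (2 : ℤ) • α')) := by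
  have := fun γ => wt_finiteDimensional hH lam γ
  refine lt_of_le_of_ne (finrank_wt_le hs hH hnb hlow hα' μ) fun heq => ?_
  have inj : ∀ w : Fin (r + 1) → ℂ, w ≠ 0 → ∀ v ∈ wt ρ lam μ,
      wittOp ρ ((2 : ℤ) • α') w v = 0 → v = 0 := fun w hw v hv =>
    eq_zero_of_wittOp_eq_zero hs hH hnb hlow hα' hw hv
  let op : (Fin (r + 1) → ℂ) → wt ρ lam μ →ₗ[ℂ] wt ρ lam (μ + (2 : ℤ) • α') := fun w =>
    (wittOp ρ ((2 : ℤ) • α') w).restrict fun v hv => wittOp_mem_wt hv _ _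
  have hop : Function.Injective (op (Pi.single 0 1)) :=
    (injective_iff_map_eq_zero _).2 fun v hv => Subtype.ext
      (inj _ (single_ne_zero' 0) v v.2 (by simpa [op] using congrArg Subtype.val hv))
  let e := LinearEquiv.ofInjectiveOfFinrankEq (op (Pi.single 0 1)) hop heq
  have : Nontrivial (wt ρ lam μ) := Submodule.nontrivial_iff_ne_bot.2 hμ
  obtain ⟨κ, hκ⟩ := Module.End.exists_eigenvalue
    (e.symm.toLinearMap ∘ₗ op (Pi.single i 1) : Module.End ℂ (wt ρ lam μ))
  obtain ⟨x, hx⟩ := hκ.exists_hasEigenvector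
  have h1 : op (Pi.single i 1) x = κ • op (Pi.single 0 1) x := by
    have := congrArg e hx.apply_eq_smul
    rwa [LinearMap.comp_apply, LinearEquiv.coe_coe, LinearEquiv.apply_symm_apply, map_smul] at this
  refine hx.2 (Subtype.ext (inj (Pi.single i 1 - κ • Pi.single 0 1) (fun h => ?_) x x.2 ?_))
  · have := congrFun h i
    simp [hi] at this
  · rw [wittOp_sub_smul]
    have := congrArg Subtype.val h1
    simpa [op, sub_eq_zero] using this

end Growth

end

end WSuper

namespace WSuper

noncomputable section

section Level

variable {r n : ℕ} {ρ : WRep (r + 1) n false} {lam : Fin (r + 1) → ℂ}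

lemma exists_eq_mul_of_cyclic {G : Type*} [AddCommGroup G] (φ : G →+ ℝ)
    {a : ℝ} (ha : φ.range = AddSubgroup.closure {a}) {g : G} (hg : φ g ≠ 0) :
    ∃ (a : ℝ) (ψ : G →+ ℤ), 0 < a ∧ Function.Surjective ψ ∧ ∀ x, φ x = a * ψ x := by
  have mem : ∀ x, ∃ k : ℤ, φ x = |a| * k := fun x => by
    have : φ x ∈ AddSubgroup.closure {a} := ha ▸ ⟨x, rfl⟩
    obtain ⟨k, hk⟩ := AddSubgroup.mem_closure_singleton.1 this
    rw [zsmul_eq_mul] at hk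
    rcases abs_choice a with h | h
    · exact ⟨k, by rw [h, ← hk, mul_comm]⟩
    · exact ⟨-k, by rw [h, ← hk]; push_cast; ring⟩
  choose k hk using mem
  have ha0 : 0 < |a| := abs_pos.2 fun h => hg (by rw [hk, h]; simp)
  have inj : ∀ i j : ℤ, |a| * i = |a| * j → i = j := fun i j h => by
    exact_mod_cast mul_left_cancel₀ ha0.ne' h
  refine ⟨|a|, AddMonoidHom.mk' k fun x y => inj _ _ ?_, ha0, fun i => ?_, hk⟩
  · rw [← hk, map_add, hk, hk]; push_cast; ring
  · obtain ⟨x, hx⟩ : |a| ∈ φ.range := by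
      rw [ha]
      rcases abs_choice a with h | h <;> rw [h]
      · exact AddSubgroup.subset_closure rfl
      · exact neg_mem (AddSubgroup.subset_closure rfl)
    refine ⟨i • x, inj _ _ ?_⟩
    rw [AddMonoidHom.mk'_apply, ← hk, map_zsmul, hx, zsmul_eq_mul, mul_comm]

lemma range_cyclic_of_fin_one (φ : LExp 1 →+ ℝ) :
    φ.range = AddSubgroup.closure {φ 1} := by
  refine le_antisymm ?_ ((AddSubgroup.closure_le _).2 (by simp))
  rintro _ ⟨x, rfl⟩
  refine AddSubgroup.mem_closure_singleton.2 ⟨x 0, ?_⟩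
  rw [← map_zsmul]
  congr 1
  ext i
  simp [Subsingleton.elim i 0]

/-- An unbounded module is graded, bounded below, by a primitive integral functional, and the
weight multiplicities grow along it. -/
lemma exists_level (hs : IsSimpleG ρ.g) (hH : IsStrongHCG ρ.g) (hnb : ¬ IsStronglyCuspidalG ρ.g)
    (h0 : wt ρ lam 0 ≠ ⊥) :
    ∃ ψ : LExp (r + 1) →+ ℤ, Function.Surjective ψ ∧
      (∃ c : ℤ, ∀ μ, wt ρ lam μ ≠ ⊥ → c ≤ ψ μ) ∧
      ∀ α', 0 < ψ α' → ∀ μ, Module.finrank ℂ (wt ρ lam μ)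
        ≤ Module.finrank ℂ (wt ρ lam (μ + (2 : ℤ) • α')) := by
  have htop := iSup_wt_eq_top hs h0
  have := fun γ => wt_finiteDimensional hH lam γ
  obtain ⟨β, v, hβ, hv0, hv⟩ := exists_kill_cone hs hH hnb htop
  have hall := forall_exists_kill_cone hs hv0 hv
  obtain ⟨N, hN, hkill⟩ := exists_forall_kill_cone hall (wt ρ lam 0)
  have hbot : ∀ κ ∈ cone β (N + 2), wt ρ lam (0 + κ) = ⊥ := fun κ hκ =>
    wt_add_eq_bot hs hH hnb hβ hall hN hkill hκ
  obtain ⟨φ, hneg, hpos⟩ := exists_separating (S := {μ | wt ρ lam μ ≠ ⊥}) (β := β) (N := N + 2)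
    h0 fun κ hκ => by simpa using hbot κ (by simpa using hκ)
  have hadd : ∀ α', 0 < φ α' → ∀ μ, wt ρ lam μ ≠ ⊥ → wt ρ lam (μ + (2 : ℤ) • α') ≠ ⊥ :=
    fun α' hα' μ hμ => wt_add_ne_bot_of_not_kill
      (fun v hv0 => not_kill_of_pos hs hH hnb hall hneg hpos hα' hv0) hμ
  obtain ⟨c, hlow⟩ := exists_le_of_support (S := {μ | wt ρ lam μ ≠ ⊥}) (φ := φ) hadd
    (μ₀ := ((N + 3 : ℕ) : ℤ) • β) fun p hp => by
      have := hbot (((N + 3 : ℕ) : ℤ) • β + p) ⟨(N + 3 : ℕ), fun i => by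
        have h1 := (Finset.mem_Icc.1 hp).1 i
        have h2 := (Finset.mem_Icc.1 hp).2 i
        simp only [Pi.zero_apply, Pi.one_apply] at h1 h2
        simp only [Pi.add_apply, Pi.smul_apply, smul_eq_mul, add_sub_cancel_left]
        rw [abs_le]; push_cast; omega⟩
      simpa using this
  have hφβ : 0 < φ (-β) := by
    have := hneg β ⟨1, fun i => by simp⟩
    rw [map_neg]; linarith
  obtain ⟨a, ha⟩ : ∃ a, φ.range = AddSubgroup.closure {a} := by
    rcases r.eq_zero_or_pos with rfl | hr
    · exact ⟨_, range_cyclic_of_fin_one φ⟩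
    refine (AddSubgroup.dense_or_cyclic φ.range).resolve_left fun hd => ?_
    have grow : ∀ k : ℕ, ∀ μ, wt ρ lam μ ≠ ⊥ → ∀ α', 0 < φ α' →
        k ≤ Module.finrank ℂ (wt ρ lam (μ + (2 : ℤ) • α')) := by
      intro k
      induction k with
      | zero => exact fun _ _ _ _ => Nat.zero_le _
      | succ k ih =>
        intro μ hμ α' hα'
        obtain ⟨_, ⟨δ, rfl⟩, hδ0, hδ⟩ := hd.exists_between hα'
        have h1 := ih μ hμ δ hδ0
        have h2 := finrank_wt_lt hs hH hnb hlow (α' := α' - δ) (by rw [map_sub]; linarith)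
          (i := Fin.last r) (by simpa [Fin.ext_iff] using hr.ne') (hadd δ hδ0 μ hμ)
        rw [add_assoc, ← smul_add, add_sub_cancel] at h2
        omega
    have := grow (Module.finrank ℂ (wt ρ lam (0 + (2 : ℤ) • -β)) + 1) 0 h0 (-β) hφβ
    omega
  obtain ⟨a, ψ, ha0, hsurj, hψ⟩ := exists_eq_mul_of_cyclic φ ha hφβ.ne'
  refine ⟨ψ, hsurj, ⟨⌊c / a⌋, fun μ hμ => ?_⟩, fun α' hα' μ => ?_⟩
  · have := hlow μ hμ
    rw [hψ, ← div_le_iff₀' ha0] at this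
    exact_mod_cast (Int.floor_le _).trans this
  · refine finrank_wt_le hs hH hnb hlow ?_ μ
    rw [hψ]
    exact mul_pos ha0 (by exact_mod_cast hα')

/-- A primitive functional is a coordinate with respect to some basis of the lattice. -/
lemma exists_gl_of_surjective (ψ : LExp (r + 1) →+ ℤ) (hψ : Function.Surjective ψ) :
    ∃ θ : Matrix.GeneralLinearGroup (Fin (r + 1)) ℤ,
      ∀ x, ψ ((θ : Matrix (Fin (r + 1)) (Fin (r + 1)) ℤ).mulVec x) = x 0 := by
  let f : LExp (r + 1) →ₗ[ℤ] ℤ := ψ.toIntLinearMap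
  obtain ⟨y, hy⟩ := hψ 1
  have hf : ∀ (z : LinearMap.ker f) (k : ℤ), f (z + k • y) = k := fun z k => by
    rw [map_add, map_smul, LinearMap.mem_ker.1 z.2]
    change 0 + k * ψ y = k
    rw [hy]; ring
  let e : (LinearMap.ker f × ℤ) ≃ₗ[ℤ] LExp (r + 1) :=
    { toFun := fun z => z.1 + z.2 • y
      map_add' := fun z w => by
        simp only [Prod.fst_add, Submodule.coe_add, Prod.snd_add, add_smul]; abel
      map_smul' := fun c z => by
        simp only [Prod.smul_fst, Prod.smul_snd, Submodule.coe_smul, RingHom.id_apply, smul_add,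
          smul_assoc]
      invFun := fun x => (⟨x - f x • y, by
        simp only [LinearMap.mem_ker, map_sub, map_smul, smul_eq_mul]
        change ψ x - ψ x * ψ y = 0
        rw [hy]; ring⟩, f x)
      left_inv := fun z => Prod.ext (Subtype.ext (by simp only [hf, add_sub_cancel_right])) (hf _ _)
      right_inv := fun x => sub_add_cancel _ _ }
  have hrank : Module.finrank ℤ (LinearMap.ker f) = Module.finrank ℤ (Fin r → ℤ) := by
    have h1 := e.finrank_eq
    rw [Module.finrank_prod, Module.finrank_fin_fun, Module.finrank_self] at h1
    rw [Module.finrank_fin_fun]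
    omega
  let L : LExp (r + 1) ≃ₗ[ℤ] LExp (r + 1) :=
    (Fin.consLinearEquiv ℤ fun _ : Fin (r + 1) => ℤ).symm ≪≫ₗ LinearEquiv.prodComm ℤ _ _ ≪≫ₗ
      LinearEquiv.prodCongr (LinearEquiv.ofFinrankEq _ _ hrank).symm (LinearEquiv.refl ℤ ℤ) ≪≫ₗ e
  refine ⟨⟨LinearMap.toMatrix' L.toLinearMap, LinearMap.toMatrix' L.symm.toLinearMap, ?_, ?_⟩,
    fun x => ?_⟩
  · rw [← LinearMap.toMatrix'_comp]; simp
  · rw [← LinearMap.toMatrix'_comp]; simp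
  · rw [LinearMap.toMatrix'_mulVec]
    exact hf _ _

end Level

end

end WSuper

namespace WSuper

noncomputable section

section Bottom

variable {r n : ℕ} {ρ : WRep (r + 1) n false} {lam : Fin (r + 1) → ℂ}

lemma wt_shift (lam : Fin (r + 1) → ℂ) (μ γ : LExp (r + 1)) :
    wt ρ (fun i => lam i + μ i) γ = wt ρ lam (μ + γ) := by
  ext v; simp [mem_wt, add_assoc]

/-- An unbounded module is graded by a primitive integral functional, starting in degree zero and
with multiplicities bounded in that degree. -/
lemma exists_lowest_level (hs : IsSimpleG ρ.g) (hH : IsStrongHCG ρ.g)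
    (hnb : ¬ IsStronglyCuspidalG ρ.g) :
    ∃ (lam : Fin (r + 1) → ℂ) (ψ : LExp (r + 1) →+ ℤ), wt ρ lam 0 ≠ ⊥ ∧ Function.Surjective ψ ∧
      (∀ μ, wt ρ lam μ ≠ ⊥ → 0 ≤ ψ μ) ∧
      ∃ C : ℕ, ∀ μ, ψ μ = 0 → Module.finrank ℂ (wt ρ lam μ) ≤ C := by
  obtain ⟨lam, h0⟩ := exists_wt_ne_bot hs hH
  obtain ⟨ψ, hsurj, ⟨c, hlow⟩, hgrow⟩ := exists_level hs hH hnb h0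
  obtain ⟨_, ⟨μ₀, hμ₀, rfl⟩, hmin⟩ := Int.exists_least_of_bdd
    (P := fun z => ∃ μ, wt ρ lam μ ≠ ⊥ ∧ ψ μ = z) ⟨c, by rintro _ ⟨μ, hμ, rfl⟩; exact hlow μ hμ⟩
    ⟨_, 0, h0, rfl⟩
  refine ⟨fun i => lam i + μ₀ i, ψ, by rwa [wt_shift, add_zero], hsurj, fun μ hμ => ?_, ?_⟩
  · rw [wt_shift] at hμ
    have := hmin _ ⟨_, hμ, rfl⟩
    rw [map_add] at this
    omega
  · obtain ⟨y, hy⟩ := hsurj 1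
    obtain ⟨M, hM⟩ := ((Finset.Icc (0 : LExp (r + 1)) 1).image fun p => -ψ p).exists_le
    refine ⟨∑ p ∈ Finset.Icc (0 : LExp (r + 1)) 1,
      Module.finrank ℂ (wt ρ lam (μ₀ + (M + 1) • y + p)), fun μ hμ => ?_⟩
    obtain ⟨p, hp, δ, hδ⟩ := exists_cube_add_two_smul (μ - (M + 1) • y)
    have e : (M + 1) • y + p = μ + (2 : ℤ) • -δ := by
      rw [smul_neg, eq_add_neg_iff_add_eq, add_assoc, ← hδ]; abel
    have h1 := congrArg ψ e
    have h2 := hM _ (Finset.mem_image_of_mem (fun p => -ψ p) hp)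
    simp only [map_add, map_zsmul, hμ, hy, smul_eq_mul] at h1
    have h3 := hgrow (-δ) (by omega) (μ₀ + μ)
    rw [add_assoc, ← e, ← add_assoc] at h3
    rw [wt_shift]
    exact h3.trans (Finset.single_le_sum
      (f := fun p => Module.finrank ℂ (wt ρ lam (μ₀ + (M + 1) • y + p)))
      (fun _ _ => Nat.zero_le _) hp)

/-- The component of level zero with respect to `ψ`. -/
def bottom (ρ : WRep (r + 1) n false) (lam : Fin (r + 1) → ℂ) (ψ : LExp (r + 1) →+ ℤ) :
    Submodule ℂ ρ.M := ⨆ γ, ⨆ (_ : ψ γ = 0), wt ρ lam γ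

/-- The sum of the components of positive level with respect to `ψ`. -/
def upper (ρ : WRep (r + 1) n false) (lam : Fin (r + 1) → ℂ) (ψ : LExp (r + 1) →+ ℤ) :
    Submodule ℂ ρ.M := ⨆ γ, ⨆ (_ : 0 < ψ γ), wt ρ lam γ

variable {ψ : LExp (r + 1) →+ ℤ}

lemma wt_le_bottom {γ : LExp (r + 1)} (h : ψ γ = 0) : wt ρ lam γ ≤ bottom ρ lam ψ :=
  le_iSup₂_of_le γ h le_rfl

lemma wt_le_upper {γ : LExp (r + 1)} (h : 0 < ψ γ) : wt ρ lam γ ≤ upper ρ lam ψ :=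
  le_iSup₂_of_le γ h le_rfl

lemma bottom_le_comap {α : LExp (r + 1)} {P : Submodule ℂ ρ.M}
    (h : ∀ γ, ψ γ = 0 → wt ρ lam (γ + α) ≤ P) (s : GExp n) (D : Dir (r + 1) n false) :
    bottom ρ lam ψ ≤ P.comap (ρ.g (α, s, D)) :=
  iSup₂_le fun γ hγ _ hv => h γ hγ (g_mem_wt hv α s D)

lemma g_mem_bottom {α : LExp (r + 1)} (hα : ψ α = 0) (s : GExp n) (D : Dir (r + 1) n false)
    {v : ρ.M} (hv : v ∈ bottom ρ lam ψ) : ρ.g (α, s, D) v ∈ bottom ρ lam ψ :=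
  bottom_le_comap (fun γ hγ => wt_le_bottom (by rw [map_add, hγ, hα, add_zero])) s D hv

lemma g_mem_upper {α : LExp (r + 1)} (hα : 0 < ψ α) (s : GExp n) (D : Dir (r + 1) n false)
    {v : ρ.M} (hv : v ∈ bottom ρ lam ψ ⊔ upper ρ lam ψ) : ρ.g (α, s, D) v ∈ upper ρ lam ψ := by
  have h1 : bottom ρ lam ψ ≤ (upper ρ lam ψ).comap (ρ.g (α, s, D)) :=
    bottom_le_comap (fun γ hγ => wt_le_upper (by rw [map_add]; omega)) s D
  have h2 : upper ρ lam ψ ≤ (upper ρ lam ψ).comap (ρ.g (α, s, D)) :=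
    iSup₂_le fun γ hγ _ hv => wt_le_upper (by rw [map_add]; omega) (g_mem_wt hv α s D)
  exact sup_le h1 h2 hv

lemma apply_eq_sum (ψ : LExp r →+ ℤ) (γ : LExp r) : ψ γ = ∑ i, ψ (Pi.single i 1) * γ i := by
  conv_lhs => rw [← Finset.univ_sum_single γ, map_sum]
  refine Finset.sum_congr rfl fun i _ => ?_
  have : (Pi.single i (γ i) : LExp r) = γ i • Pi.single i 1 := by
    rw [← Pi.single_smul]; simp
  rw [this, map_zsmul, smul_eq_mul, mul_comm]

lemma disjoint_bottom_upper : Disjoint (bottom ρ lam ψ) (upper ρ lam ψ) := by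
  let w : Fin (r + 1) → ℂ := fun i => ψ (Pi.single i 1)
  have hwt : ∀ γ, wt ρ lam γ
      ≤ Module.End.eigenspace (wittOp ρ 0 w) (∑ i, w i * lam i + (ψ γ : ℂ)) := by
    intro γ v hv
    rw [Module.End.mem_eigenspace_iff, wittOp, LinearMap.sum_apply, apply_eq_sum ψ γ, Int.cast_sum,
      ← Finset.sum_add_distrib, Finset.sum_smul]
    refine Finset.sum_congr rfl fun i _ => ?_
    rw [LinearMap.smul_apply, mem_wt.1 hv, smul_smul]
    congr 1
    push_cast
    ring
  refine (Module.End.eigenspaces_iSupIndep (wittOp ρ 0 w) (∑ i, w i * lam i)).mono ?_ ?_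
  · exact iSup₂_le fun γ hγ => (hwt γ).trans (by rw [hγ, Int.cast_zero, add_zero])
  · refine iSup₂_le fun γ hγ => le_iSup₂_of_le _ ?_ (hwt γ)
    simpa using hγ.ne'

/-- The lowest component is simple over the zero component of the grading. -/
lemma bottom_le_of_invariant (hs : IsSimpleG ρ.g) (hlow : ∀ μ, wt ρ lam μ ≠ ⊥ → 0 ≤ ψ μ)
    {N : Submodule ℂ ρ.M} (hN : N ≤ bottom ρ lam ψ) (hN0 : N ≠ ⊥)
    (hinv : ∀ γ s D, ψ γ = 0 → ∀ v ∈ N, ρ.g (γ, s, D) v ∈ N) : bottom ρ lam ψ ≤ N := by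
  let 𝒬 : Set (Submodule ℂ ρ.M) :=
    {Q | N ≤ Q ∧ ∀ γ s D, 0 < ψ γ → ∀ v ∈ Q, ρ.g (γ, s, D) v ∈ Q}
  let R := sInf 𝒬
  have hNR : N ≤ R := le_sInf fun Q hQ => hQ.1
  have hR : ∀ γ s D, 0 < ψ γ → ∀ v ∈ R, ρ.g (γ, s, D) v ∈ R := fun γ s D hγ v hv =>
    (Submodule.mem_sInf).2 fun Q hQ => hQ.2 γ s D hγ v ((Submodule.mem_sInf).1 hv Q hQ)
  let R' : Submodule ℂ ρ.M := R ⊓ ⨅ z : WBasis (r + 1) n false, R.comap (ρ.g z)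
  have hR' : ∀ {v}, v ∈ R' ↔ v ∈ R ∧ ∀ z, ρ.g z v ∈ R := by
    intro v; simp only [R', Submodule.mem_inf, Submodule.mem_iInf, Submodule.mem_comap]
  have hmem : R' ∈ 𝒬 := by
    refine ⟨fun v hv => hR'.2 ⟨hNR hv, ?_⟩, fun β s D hβ v hv => ?_⟩
    · rintro ⟨γ, s, D⟩
      rcases lt_trichotomy (ψ γ) 0 with h | h | h
      · have := bottom_le_comap (ρ := ρ) (lam := lam) (ψ := ψ) (α := γ) (P := ⊥) (fun δ hδ => by
          by_contra hne
          have := hlow (δ + γ) fun h => hne h.le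
          rw [map_add] at this
          omega) s D (hN hv)
        rw [Submodule.mem_comap, Submodule.mem_bot] at this
        rw [this]
        exact zero_mem _
      · exact hNR (hinv γ s D h v hv)
      · exact hR γ s D h v (hNR hv)
    · obtain ⟨hv1, hv2⟩ := hR'.1 hv
      refine hR'.2 ⟨hR β s D hβ v hv1, ?_⟩
      rintro ⟨γ, q, D'⟩
      exact g_g_mem (hR β s D hβ _ (hv2 _)) fun s D => hv2 _
  have hRR' : R ≤ R' := sInf_le hmem
  obtain ⟨v₀, hv₀, hne⟩ := Submodule.exists_mem_ne_zero_of_ne_bot hN0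
  have htop : R = ⊤ := eq_top_of_invariant hs
    (fun γ s D v hv => (hR'.1 (hRR' hv)).2 _) (hNR hv₀) hne
  have hle : R ≤ N ⊔ upper ρ lam ψ := sInf_le ⟨le_sup_left, fun γ s D hγ v hv =>
    (le_sup_right : upper ρ lam ψ ≤ _) (g_mem_upper hγ s D (sup_le_sup_right hN _ hv))⟩
  intro v hv
  obtain ⟨a, ha, b, hb, rfl⟩ := Submodule.mem_sup.1 (hle (htop ▸ Submodule.mem_top : v ∈ R))
  have hb' : b ∈ bottom ρ lam ψ := by
    have := Submodule.sub_mem _ hv (hN ha)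
    rwa [add_sub_cancel_left] at this
  rw [Submodule.disjoint_def.1 disjoint_bottom_upper b hb' hb, add_zero]
  exact ha

end Bottom

section OddCartan

lemma exists_joint_eigenvector {V ι : Type*} [AddCommGroup V] [Module ℂ V] [Finite ι]
    {P : Submodule ℂ V} [FiniteDimensional ℂ P] (hP : P ≠ ⊥) (T : ι → Module.End ℂ V)
    (hT : ∀ a, ∀ v ∈ P, T a v ∈ P) (hcomm : ∀ a b v, T a (T b v) = T b (T a v)) :
    ∃ (mu : ι → ℂ), ∃ v ∈ P, v ≠ 0 ∧ ∀ a, T a v = mu a • v := by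
  classical
  have := Fintype.ofFinite ι
  suffices h : ∀ S : Finset ι, ∃ mu : ι → ℂ, ∃ v ∈ P, v ≠ 0 ∧ ∀ a ∈ S, T a v = mu a • v by
    simpa using h Finset.univ
  intro S
  induction S using Finset.induction_on with
  | empty =>
    obtain ⟨v, hv, hv0⟩ := Submodule.exists_mem_ne_zero_of_ne_bot hP
    exact ⟨0, v, hv, hv0, by simp⟩
  | insert b S hb ih =>
    obtain ⟨mu, v, hv, hv0, hS⟩ := ih
    let U : Submodule ℂ V := P ⊓ ⨅ a ∈ S, Module.End.eigenspace (T a) (mu a)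
    have hU : ∀ {u}, u ∈ U ↔ u ∈ P ∧ ∀ a ∈ S, T a u = mu a • u := by
      intro u
      simp only [U, Submodule.mem_inf, Submodule.mem_iInf, Module.End.mem_eigenspace_iff]
    have : FiniteDimensional ℂ U := Submodule.finiteDimensional_of_le inf_le_left
    have : Nontrivial U := ⟨⟨v, hU.2 ⟨hv, hS⟩⟩, 0, fun h => hv0 (congrArg Subtype.val h)⟩
    have hTU : ∀ u ∈ U, T b u ∈ U := fun u hu => by
      obtain ⟨h1, h2⟩ := hU.1 hu
      exact hU.2 ⟨hT b u h1, fun a ha => by rw [hcomm, h2 a ha, map_smul]⟩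
    obtain ⟨κ, hκ⟩ := Module.End.exists_eigenvalue
      ((T b).restrict hTU : Module.End ℂ U)
    obtain ⟨x, hx⟩ := hκ.exists_hasEigenvector
    obtain ⟨hx1, hx2⟩ := hU.1 x.2
    refine ⟨Function.update mu b κ, x, hx1, fun h => hx.2 (Subtype.ext h), fun a ha => ?_⟩
    rcases Finset.mem_insert.1 ha with rfl | ha
    · rw [Function.update_self]
      exact congrArg Subtype.val hx.apply_eq_smul
    · rw [Function.update_of_ne (ne_of_mem_of_not_mem ha hb)]
      exact hx2 a ha

variable {r n : ℕ} {ρ : WRep r n false} {lam : Fin r → ℂ}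

lemma derC_hpp (a b : Fin n) :
    derC b (fun x => decide (x = a)) = if b = a then 1 else 0 := by
  by_cases h : b = a
  · subst h
    have : (Finset.univ.filter fun x : Fin n => x = b ∧ x < b) = ∅ :=
      Finset.filter_eq_empty_iff.2 fun x _ hx => hx.2.ne hx.1
    simp [derC, this]
  · simp [derC, h]

lemma exists_brB_hppB (a : Fin n) (p : LExp r) (q : GExp n) (D : Dir r n false) :
    ∃ c : ℂ, brB (hppB r n false a) (p, q, D) = c • sng (p, q, D) := by
  have h1 : derC a q = 0 ∨ xorE (fun x => decide (x = a)) (derE a q) = q := by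
    by_cases h : q a = true
    · right
      funext x
      by_cases hx : x = a
      · subst hx; simp [xorE, derE, h]
      · simp [xorE, derE, hx]
    · left; simp [derC, h]
  have h2 : derE a (fun x => decide (x = a)) = gzero := by
    funext x
    by_cases hx : x = a
    · subst hx; simp [derE, gzero]
    · simp [derE, hx, gzero]
  cases D with
  | di j =>
    rcases h1 with h | h
    · exact ⟨0, by simp [hppB, brB, h]⟩
    · exact ⟨derC a q * mulSgn (fun x => decide (x = a)) (derE a q), by simp [hppB, brB, h]⟩
  | pa b =>
    simp only [hppB, brB, zero_add, derC_hpp]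
    have h3 : ∃ c : ℂ, (derC a q * mulSgn (fun x => decide (x = a)) (derE a q)) •
        sng (b := false) (p, xorE (fun x => decide (x = a)) (derE a q), Dir.pa b)
        = c • sng (p, q, Dir.pa b) := by
      rcases h1 with h | h
      · exact ⟨0, by simp [h]⟩
      · exact ⟨_, by rw [h]⟩
    obtain ⟨c, hc⟩ := h3
    rw [hc]
    by_cases hba : b = a
    · subst hba
      rw [h2, xorE_gzero_right, ← sub_smul]
      exact ⟨_, rfl⟩
    · exact ⟨c, by simp [hba]⟩

lemma par_hppB (a : Fin n) : par (hppB r n false a) = 0 := by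
  have : (Finset.univ.filter fun x : Fin n => x = a) = {a} := by ext; simp
  simp [par, hppB, gdeg, this]

lemma hppB_bracket (a : Fin n) (z : WBasis r n false) (v : ρ.M) :
    ρ.g (hppB r n false a) (ρ.g z v) - ρ.g z (ρ.g (hppB r n false a) v)
      = ρ.act (brB (hppB r n false a) z) v := by
  rw [ρ.super]
  simp [par_hppB, WRep.g]

lemma exists_hppB_comm (a : Fin n) (z : WBasis r n false) :
    ∃ c : ℂ, ∀ v, ρ.g (hppB r n false a) (ρ.g z v)
      = ρ.g z (ρ.g (hppB r n false a) v) + c • ρ.g z v := by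
  obtain ⟨c, hc⟩ := exists_brB_hppB a z.1 z.2.1 z.2.2
  refine ⟨c, fun v => ?_⟩
  rw [← sub_eq_iff_eq_add', hppB_bracket, hc]
  simp [WRep.g]

lemma hppB_comm (a b : Fin n) (v : ρ.M) :
    ρ.g (hppB r n false a) (ρ.g (hppB r n false b) v)
      = ρ.g (hppB r n false b) (ρ.g (hppB r n false a) v) := by
  by_cases h : a = b
  · rw [h]
  · rw [← sub_eq_zero, hppB_bracket]
    simp [hppB, brB, derC_hpp, h, Ne.symm h]

/-- Weight spaces for the full Cartan subalgebra. -/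
def fullWt (ρ : WRep r n false) (lam : Fin r → ℂ) (γ : LExp r) (mu : Fin n → ℂ) :
    Submodule ℂ ρ.M :=
  wt ρ lam γ ⊓ ⨅ a, Module.End.eigenspace (ρ.g (hppB r n false a)) (mu a)

lemma mem_fullWt {γ : LExp r} {mu : Fin n → ℂ} {v : ρ.M} :
    v ∈ fullWt ρ lam γ mu ↔ v ∈ wt ρ lam γ ∧ ∀ a, ρ.g (hppB r n false a) v = mu a • v := by
  simp only [fullWt, Submodule.mem_inf, Submodule.mem_iInf, Module.End.mem_eigenspace_iff]

lemma exists_fullWt_ne_bot (hH : IsStrongHCG ρ.g) {γ : LExp r} (h : wt ρ lam γ ≠ ⊥) :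
    ∃ mu, fullWt ρ lam γ mu ≠ ⊥ := by
  have := wt_finiteDimensional hH lam γ
  obtain ⟨mu, v, hv, hv0, hmu⟩ := exists_joint_eigenvector h
    (fun a => ρ.g (hppB r n false a))
    (fun a v hv => by simpa [hppB] using g_mem_wt hv 0 (fun x => decide (x = a)) (.pa a)) hppB_comm
  exact ⟨mu, (Submodule.ne_bot_iff _).2 ⟨v, mem_fullWt.2 ⟨hv, hmu⟩, hv0⟩⟩

lemma exists_g_mem_fullWt {γ : LExp r} (mu : Fin n → ℂ) (α : LExp r) (s : GExp n)
    (D : Dir r n false) : ∃ mu', ∀ v ∈ fullWt ρ lam γ mu,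
      ρ.g (α, s, D) v ∈ fullWt ρ lam (γ + α) mu' := by
  choose c hc using fun a => exists_hppB_comm (ρ := ρ) a (α, s, D)
  refine ⟨fun a => mu a + c a, fun v hv => ?_⟩
  obtain ⟨h1, h2⟩ := mem_fullWt.1 hv
  exact mem_fullWt.2 ⟨g_mem_wt h1 α s D, fun a => by rw [hc, h2, map_smul, add_smul]⟩

end OddCartan

section BottomCuspidal

variable {r n : ℕ} {ρ : WRep (r + 1) n false} {lam : Fin (r + 1) → ℂ} {ψ : LExp (r + 1) →+ ℤ}

/-- The odd Cartan subalgebra acts diagonalizably on the lowest component. -/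
lemma bottom_le_iSup_fullWt (hs : IsSimpleG ρ.g) (hH : IsStrongHCG ρ.g) (h0 : wt ρ lam 0 ≠ ⊥)
    (hlow : ∀ μ, wt ρ lam μ ≠ ⊥ → 0 ≤ ψ μ) :
    bottom ρ lam ψ ≤ ⨆ γ, ⨆ (_ : ψ γ = 0), ⨆ mu, fullWt ρ lam γ mu := by
  refine bottom_le_of_invariant hs hlow ?_ ?_ ?_
  · exact iSup₂_le fun γ hγ => iSup_le fun mu => inf_le_left.trans (wt_le_bottom hγ)
  · obtain ⟨mu, hmu⟩ := exists_fullWt_ne_bot hH h0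
    intro h
    refine hmu (le_bot_iff.1 (h ▸ ?_))
    exact le_iSup₂_of_le 0 (map_zero ψ) (le_iSup _ mu)
  · intro α s D hα v hv
    have : (⨆ γ, ⨆ (_ : ψ γ = 0), ⨆ mu, fullWt ρ lam γ mu)
        ≤ (⨆ γ, ⨆ (_ : ψ γ = 0), ⨆ mu, fullWt ρ lam γ mu).comap (ρ.g (α, s, D)) := by
      refine iSup₂_le fun γ hγ => iSup_le fun mu w hw => ?_
      obtain ⟨mu', h⟩ := exists_g_mem_fullWt (ρ := ρ) (lam := lam) (γ := γ) mu α s D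
      have hle : fullWt ρ lam (γ + α) mu' ≤ ⨆ γ, ⨆ (_ : ψ γ = 0), ⨆ mu, fullWt ρ lam γ mu :=
        le_iSup₂_of_le (γ + α) (by rw [map_add, hγ, hα, add_zero]) (le_iSup _ mu')
      exact hle (h w hw)
    exact this hv

end BottomCuspidal

end

end WSuper

namespace WSuper

noncomputable section

section Twist

variable {r n : ℕ} {ρ : WRep r n false} (θ : Matrix.GeneralLinearGroup (Fin r) ℤ)

lemma mulVec_mulVec_inv (γ : LExp r) :
    (θ : Matrix (Fin r) (Fin r) ℤ).mulVec
      (((θ⁻¹ : Matrix.GeneralLinearGroup (Fin r) ℤ) : Matrix (Fin r) (Fin r) ℤ).mulVec γ) = γ := by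
  rw [Matrix.mulVec_mulVec, Units.mul_inv, Matrix.one_mulVec]

lemma sum_gl_mul_inv (θ : Matrix.GeneralLinearGroup (Fin r) ℤ) (i l : Fin r) :
    ∑ j, ((θ : Matrix (Fin r) (Fin r) ℤ) i j : ℂ)
      * (((θ⁻¹ : Matrix.GeneralLinearGroup (Fin r) ℤ) : Matrix (Fin r) (Fin r) ℤ) j l : ℂ)
      = if i = l then 1 else 0 := by
  have := congrFun (congrFun (Units.mul_inv θ) i) l
  rw [Matrix.mul_apply, Matrix.one_apply] at this
  exact_mod_cast this

lemma act_twB_di (x : LExp r) (s : GExp n) (i : Fin r) (v : ρ.M) :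
    ρ.act (twB θ (x, s, .di i)) v = ∑ j,
      (((θ⁻¹ : Matrix.GeneralLinearGroup (Fin r) ℤ) : Matrix (Fin r) (Fin r) ℤ) i j : ℂ) •
        ρ.g ((θ : Matrix (Fin r) (Fin r) ℤ).mulVec x, s, .di j) v := by
  simp [twB, WRep.g, LinearMap.sum_apply]

lemma act_twB_pa (x : LExp r) (s : GExp n) (a : Fin n) (v : ρ.M) :
    ρ.act (twB θ (x, s, .pa a)) v
      = ρ.g ((θ : Matrix (Fin r) (Fin r) ℤ).mulVec x, s, .pa a) v := rfl

lemma sum_smul_sum {V : Type*} [AddCommGroup V] [Module ℂ V]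
    (θ : Matrix.GeneralLinearGroup (Fin r) ℤ) (f : Fin r → V) (j : Fin r) :
    ∑ i, ((θ : Matrix (Fin r) (Fin r) ℤ) j i : ℂ) • ∑ l,
      (((θ⁻¹ : Matrix.GeneralLinearGroup (Fin r) ℤ) : Matrix (Fin r) (Fin r) ℤ) i l : ℂ) • f l
      = f j := by
  simp only [Finset.smul_sum, smul_smul]
  rw [Finset.sum_comm]
  simp only [← Finset.sum_smul, sum_gl_mul_inv]
  simp

lemma g_eq_sum_twB (x : LExp r) (s : GExp n) (j : Fin r) (v : ρ.M) :
    ρ.g ((θ : Matrix (Fin r) (Fin r) ℤ).mulVec x, s, .di j) v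
      = ∑ i, ((θ : Matrix (Fin r) (Fin r) ℤ) j i : ℂ) • ρ.act (twB θ (x, s, .di i)) v := by
  simp only [act_twB_di]
  exact (sum_smul_sum θ (fun l => ρ.g ((θ : Matrix (Fin r) (Fin r) ℤ).mulVec x, s, .di l) v) j).symm

lemma mem_wtG_twB {mu : HIdx r false → ℂ} {v : ρ.M} :
    v ∈ wtG (fun x => ρ.act (twB θ x)) mu ↔ v ∈ wtG ρ.g
      (Sum.elim (fun j => ∑ i, ((θ : Matrix (Fin r) (Fin r) ℤ) j i : ℂ) * mu (.inl i))
        fun j => j.elim0) := by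
  rw [mem_wtG, mem_wtG]
  constructor
  · intro h j
    have := g_eq_sum_twB θ 0 gzero j v
    rw [Matrix.mulVec_zero] at this
    rw [this, Sum.elim_inl, Finset.sum_smul]
    exact Finset.sum_congr rfl fun i _ => by rw [h i, smul_smul]
  · intro h i
    rw [act_twB_di, Matrix.mulVec_zero]
    simp only [h, Sum.elim_inl]
    have := sum_smul_sum θ⁻¹ (fun l => mu (.inl l) • v) i
    rw [inv_inv] at this
    rw [← this]
    refine Finset.sum_congr rfl fun j _ => ?_
    rw [Finset.sum_smul]
    simp only [smul_smul]

/-- The weight `θ⁻¹ lam` of the twisted module. -/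
def twWt (lam : Fin r → ℂ) : HIdx r false → ℂ :=
  Sum.elim (fun i => ∑ j,
    (((θ⁻¹ : Matrix.GeneralLinearGroup (Fin r) ℤ) : Matrix (Fin r) (Fin r) ℤ) i j : ℂ) * lam j)
    fun j => j.elim0

lemma wtG_twWt_add (lam : Fin r → ℂ) (k : HIdx r false → ℤ) :
    wtG (fun x => ρ.act (twB θ x)) (fun h => twWt θ lam h + (k h : ℂ))
      = wt ρ lam ((θ : Matrix (Fin r) (Fin r) ℤ).mulVec fun i => k (.inl i)) := by
  ext v
  rw [mem_wtG_twB, mem_wtG, mem_wt]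
  refine forall_congr' fun j => ?_
  have h1 : ∑ i, ((θ : Matrix (Fin r) (Fin r) ℤ) j i : ℂ) * twWt θ lam (.inl i) = lam j := by
    simpa only [smul_eq_mul, twWt, Sum.elim_inl] using sum_smul_sum θ lam j
  simp only [Sum.elim_inl, mul_add, Finset.sum_add_distrib, h1, Matrix.mulVec, dotProduct]
  push_cast
  rfl

lemma exists_eq_twWt_add {lam : Fin r → ℂ} (htop : ⨆ γ, wt ρ lam γ = ⊤)
    {mu : HIdx r false → ℂ} (hmu : wtG (fun x => ρ.act (twB θ x)) mu ≠ ⊥) :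
    ∃ k : HIdx r false → ℤ, mu = fun h => twWt θ lam h + (k h : ℂ) := by
  have h1 : wtG (fun x => ρ.act (twB θ x)) mu = wtG ρ.g
      (Sum.elim (fun j => ∑ i, ((θ : Matrix (Fin r) (Fin r) ℤ) j i : ℂ) * mu (.inl i))
        fun j => j.elim0) := Submodule.ext fun v => mem_wtG_twB θ
  rw [h1] at hmu
  obtain ⟨γ, hγ⟩ := exists_eq_add_of_wtG_ne_bot htop hmu
  refine ⟨Sum.elim (((θ⁻¹ : Matrix.GeneralLinearGroup (Fin r) ℤ) :
    Matrix (Fin r) (Fin r) ℤ).mulVec γ) fun j => j.elim0, ?_⟩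
  funext h
  rcases h with i | j
  · have := sum_smul_sum θ⁻¹ (fun l => mu (.inl l)) i
    simp only [inv_inv, smul_eq_mul] at this
    simp only [Sum.elim_inl] at hγ
    simp only [hγ, mul_add, Finset.sum_add_distrib] at this
    rw [← this]
    simp only [twWt, Sum.elim_inl, Matrix.mulVec, dotProduct]
    push_cast
    rfl
  · exact j.elim0

end Twist

section Final

variable {m n : ℕ} {ρ : WRep (m + 1) n false} {θ : Matrix.GeneralLinearGroup (Fin (m + 1)) ℤ}
  {ψ : LExp (m + 1) →+ ℤ} {lam : Fin (m + 1) → ℂ}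

lemma iSup_wtG_twB
    (hθ : ∀ x, ψ ((θ : Matrix (Fin (m + 1)) (Fin (m + 1)) ℤ).mulVec x) = x 0) :
    (⨆ k ∈ {k : HIdx (m + 1) false → ℤ | k (Sum.inl 0) = 0},
      wtG (fun x => ρ.act (twB θ x)) (fun h => twWt θ lam h + (k h : ℂ))) = bottom ρ lam ψ := by
  refine le_antisymm (iSup₂_le fun k hk => ?_) (iSup₂_le fun γ hγ => ?_)
  · rw [wtG_twWt_add]
    exact wt_le_bottom ((hθ _).trans hk)
  · have h := mulVec_mulVec_inv θ γ
    refine le_iSup₂_of_le (Sum.elim (((θ⁻¹ : Matrix.GeneralLinearGroup (Fin (m + 1)) ℤ) :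
      Matrix (Fin (m + 1)) (Fin (m + 1)) ℤ).mulVec γ) fun j => j.elim0) ?_ ?_
    · change Matrix.mulVec _ γ 0 = 0
      exact (hθ _).symm.trans (by rw [h, hγ])
    · rw [wtG_twWt_add]
      simp only [Sum.elim_inl]
      rw [h]

lemma act_twB_mem {P : Submodule ℂ ρ.M} {v : ρ.M} {x : LExp (m + 1)}
    (h : ∀ s D, ρ.g ((θ : Matrix (Fin (m + 1)) (Fin (m + 1)) ℤ).mulVec x, s, D) v ∈ P)
    (s : GExp n) (D : Dir (m + 1) n false) : ρ.act (twB θ (x, s, D)) v ∈ P := by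
  cases D with
  | di i =>
    rw [act_twB_di]
    exact Submodule.sum_mem _ fun j _ => Submodule.smul_mem _ _ (h _ _)
  | pa a => exact h _ _

lemma g_mem_of_embB {P : Submodule ℂ ρ.M} {v : ρ.M}
    (hθ : ∀ x, ψ ((θ : Matrix (Fin (m + 1)) (Fin (m + 1)) ℤ).mulVec x) = x 0)
    (h : ∀ x : WBasis m n true, ρ.act (twB θ (embB x)) v ∈ P) {γ : LExp (m + 1)} (hγ : ψ γ = 0)
    (s : GExp n) (D : Dir (m + 1) n false) : ρ.g (γ, s, D) v ∈ P := by
  obtain ⟨x, rfl⟩ : ∃ x, (θ : Matrix (Fin (m + 1)) (Fin (m + 1)) ℤ).mulVec x = γ :=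
    ⟨_, mulVec_mulVec_inv θ γ⟩
  rw [hθ] at hγ
  obtain ⟨y, rfl⟩ : ∃ y : LExp m, x = Fin.cons 0 y := ⟨Fin.tail x, by
    rw [← hγ, Fin.cons_self_tail]⟩
  cases D with
  | pa a => exact h (y, s, .pa a)
  | di j =>
    rw [g_eq_sum_twB]
    refine Submodule.sum_mem _ fun i _ => Submodule.smul_mem _ _ ?_
    refine Fin.cases ?_ (fun i => ?_) i
    · exact h (y, s, .d0)
    · exact h (y, s, .di i)

lemma act_embB_mem_bottom
    (hθ : ∀ x, ψ ((θ : Matrix (Fin (m + 1)) (Fin (m + 1)) ℤ).mulVec x) = x 0)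
    (x : WBasis m n true) (v : ρ.M) (hv : v ∈ bottom ρ lam ψ) :
    ρ.act (twB θ (embB x)) v ∈ bottom ρ lam ψ := by
  have h : ∀ (y : LExp m) s D, ρ.act (twB θ (Fin.cons 0 y, s, D)) v ∈ bottom ρ lam ψ :=
    fun y => act_twB_mem fun s D => g_mem_bottom (by rw [hθ, Fin.cons_zero]) s D hv
  obtain ⟨y, s, D⟩ := x
  cases D <;> exact h y _ _

lemma isSimpleG_bottom (hs : IsSimpleG ρ.g) (h0 : wt ρ lam 0 ≠ ⊥)
    (hlow : ∀ μ, wt ρ lam μ ≠ ⊥ → 0 ≤ ψ μ)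
    (hθ : ∀ x, ψ ((θ : Matrix (Fin (m + 1)) (Fin (m + 1)) ℤ).mulVec x) = x 0) :
    IsSimpleG fun x : WBasis m n true => (ρ.act (twB θ (embB x))).restrict
      (act_embB_mem_bottom (lam := lam) hθ x) := by
  refine ⟨?_, fun N hN => or_iff_not_imp_left.2 fun hN0 => ?_⟩
  · obtain ⟨v, hv, hv0⟩ := Submodule.exists_mem_ne_zero_of_ne_bot h0
    exact ⟨⟨v, wt_le_bottom (map_zero ψ) hv⟩, fun h => hv0 (congrArg Subtype.val h)⟩
  · have hle : bottom ρ lam ψ ≤ N.map (bottom ρ lam ψ).subtype := by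
      refine bottom_le_of_invariant hs hlow (Submodule.map_subtype_le _ _) ?_ ?_
      · intro h
        refine hN0 (Submodule.map_injective_of_injective
          (Submodule.subtype_injective (bottom ρ lam ψ)) ?_)
        rw [h, Submodule.map_bot]
      · rintro γ s D hγ _ ⟨v, hv, rfl⟩
        exact g_mem_of_embB (P := N.map (bottom ρ lam ψ).subtype) hθ
          (fun x => Submodule.mem_map.2 ⟨_, hN x v hv, rfl⟩) hγ s D
    refine Submodule.eq_top_iff'.2 fun v => ?_
    obtain ⟨y, hy, hyv⟩ := hle v.2
    rwa [← Subtype.ext hyv]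

/-- The weight of `W(m+1,n)` attached to a weight of `W(m,n) ⋉ A d_0`. -/
def liftWt (nu : HIdx m true → ℂ) : HIdx (m + 1) false → ℂ :=
  Sum.elim (Fin.cons (nu (.inr (0 : Fin 1))) fun i => nu (.inl i)) fun j => j.elim0

lemma cons_zero_zero : (Fin.cons 0 (0 : LExp m) : LExp (m + 1)) = 0 := by
  funext i
  refine Fin.cases ?_ (fun i => ?_) i <;> simp

lemma mem_wtG_restrict
    (hθ : ∀ x, ψ ((θ : Matrix (Fin (m + 1)) (Fin (m + 1)) ℤ).mulVec x) = x 0)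
    {nu : HIdx m true → ℂ} {u : bottom ρ lam ψ} :
    u ∈ wtG (fun x : WBasis m n true => (ρ.act (twB θ (embB x))).restrict
      (act_embB_mem_bottom (lam := lam) hθ x)) nu ↔
      (u : ρ.M) ∈ wtG (fun x => ρ.act (twB θ x)) (liftWt nu) := by
  have h1 : ∀ i, embB (hB m n true (.inl i)) = (0, gzero, .di i.succ) := fun i => by
    simp only [hB, embB, cons_zero_zero]
  have h2 : embB (hB m n true (.inr (0 : Fin 1))) = (0, gzero, .di 0) := by
    simp only [hB, embB, cons_zero_zero]
  rw [mem_wtG]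
  simp only [wtG, Submodule.mem_iInf, LinearMap.mem_ker, LinearMap.sub_apply,
    LinearMap.smul_apply, LinearMap.id_apply, sub_eq_zero, Subtype.ext_iff,
    LinearMap.coe_restrict_apply, Submodule.coe_smul]
  constructor
  · intro h i
    refine Fin.cases ?_ (fun i => ?_) i
    · have := h (.inr (0 : Fin 1))
      rwa [h2] at this
    · have := h (.inl i)
      rwa [h1] at this
  · rintro h (i | j)
    · rw [h1]; exact h i.succ
    · obtain rfl : j = (0 : Fin 1) := Subsingleton.elim (α := Fin 1) _ _
      rw [h2]; exact h 0

lemma embB_hppB (a : Fin n) : embB (hppB m n true a) = hppB (m + 1) n false a := by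
  simp only [hppB, embB, cons_zero_zero]

lemma act_twB_hppB (a : Fin n) (v : ρ.M) :
    ρ.act (twB θ (hppB (m + 1) n false a)) v = ρ.g (hppB (m + 1) n false a) v := by
  rw [hppB, act_twB_pa, Matrix.mulVec_zero]

lemma mem_wtFullG_restrict
    (hθ : ∀ x, ψ ((θ : Matrix (Fin (m + 1)) (Fin (m + 1)) ℤ).mulVec x) = x 0)
    {nu : HIdx m true → ℂ} {mu : Fin n → ℂ} {u : bottom ρ lam ψ} :
    u ∈ wtFullG (fun x : WBasis m n true => (ρ.act (twB θ (embB x))).restrict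
      (act_embB_mem_bottom (lam := lam) hθ x)) nu mu ↔
      (u : ρ.M) ∈ wtG (fun x => ρ.act (twB θ x)) (liftWt nu) ∧
        ∀ a, ρ.g (hppB (m + 1) n false a) u = mu a • (u : ρ.M) := by
  rw [wtFullG, Submodule.mem_inf, mem_wtG_restrict hθ]
  simp only [Submodule.mem_iInf, LinearMap.mem_ker, LinearMap.sub_apply,
    LinearMap.smul_apply, LinearMap.id_apply, sub_eq_zero, Subtype.ext_iff,
    LinearMap.coe_restrict_apply, Submodule.coe_smul, embB_hppB, act_twB_hppB]

lemma isCuspidalG_bottom (hs : IsSimpleG ρ.g) (hH : IsStrongHCG ρ.g) (h0 : wt ρ lam 0 ≠ ⊥)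
    (hlow : ∀ μ, wt ρ lam μ ≠ ⊥ → 0 ≤ ψ μ) {C : ℕ}
    (hC : ∀ μ, ψ μ = 0 → Module.finrank ℂ (wt ρ lam μ) ≤ C)
    (hθ : ∀ x, ψ ((θ : Matrix (Fin (m + 1)) (Fin (m + 1)) ℤ).mulVec x) = x 0) :
    IsCuspidalG fun x : WBasis m n true => (ρ.act (twB θ (embB x))).restrict
      (act_embB_mem_bottom (lam := lam) hθ x) := by
  set G : GAct m n true (bottom ρ lam ψ) := fun x => (ρ.act (twB θ (embB x))).restrict
    (act_embB_mem_bottom (lam := lam) hθ x)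
  have hfin := fun γ => wt_finiteDimensional hH lam γ
  have key : ∀ nu mu, wtFullG G nu mu ≠ ⊥ → ∃ γ, ψ γ = 0 ∧
      (wtFullG G nu mu).map (bottom ρ lam ψ).subtype ≤ wt ρ lam γ := by
    intro nu mu hne
    obtain ⟨u, hu, hu0⟩ := Submodule.exists_mem_ne_zero_of_ne_bot hne
    have hu' := (mem_wtFullG_restrict hθ).1 hu
    have hu0' : (u : ρ.M) ≠ 0 := fun h => hu0 (Subtype.ext h)
    obtain ⟨k, hk⟩ := exists_eq_twWt_add θ (iSup_wt_eq_top hs h0)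
      ((Submodule.ne_bot_iff _).2 ⟨u, hu'.1, hu0'⟩)
    have hle : (wtFullG G nu mu).map (bottom ρ lam ψ).subtype
        ≤ wt ρ lam ((θ : Matrix (Fin (m + 1)) (Fin (m + 1)) ℤ).mulVec fun i => k (.inl i)) := by
      rintro _ ⟨w, hw, rfl⟩
      have := ((mem_wtFullG_restrict hθ).1 hw).1
      rwa [hk, wtG_twWt_add] at this
    refine ⟨_, ?_, hle⟩
    have huγ := hle ⟨u, hu, rfl⟩
    refine le_antisymm ?_ (hlow _ ((Submodule.ne_bot_iff _).2 ⟨_, huγ, hu0'⟩))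
    by_contra! hpos
    exact hu0' (Submodule.disjoint_def.1 disjoint_bottom_upper _ u.2 (wt_le_upper hpos huγ))
  have hrank : ∀ nu mu, FiniteDimensional ℂ (wtFullG G nu mu) ∧
      Module.finrank ℂ (wtFullG G nu mu) ≤ C := by
    intro nu mu
    by_cases hne : wtFullG G nu mu = ⊥
    · rw [hne]
      exact ⟨inferInstance, by simp⟩
    · obtain ⟨γ, hγ, hle⟩ := key nu mu hne
      have e := Submodule.equivMapOfInjective (bottom ρ lam ψ).subtype
        (Submodule.subtype_injective _) (wtFullG G nu mu)
      have hfd := Submodule.finiteDimensional_of_le hle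
      refine ⟨e.symm.finiteDimensional, ?_⟩
      rw [e.finrank_eq]
      exact (Submodule.finrank_mono hle).trans (hC γ hγ)
  refine ⟨⟨?_, fun nu mu => (hrank nu mu).1⟩, C, fun nu mu => (hrank nu mu).2⟩
  have hle : bottom ρ lam ψ
      ≤ (⨆ nu, ⨆ mu, wtFullG G nu mu).map (bottom ρ lam ψ).subtype := by
    refine (bottom_le_iSup_fullWt hs hH h0 hlow).trans
      (iSup₂_le fun γ hγ => iSup_le fun mu v hv => ?_)
    obtain ⟨hv1, hv2⟩ := mem_fullWt.1 hv
    have hk : (θ : Matrix (Fin (m + 1)) (Fin (m + 1)) ℤ).mulVec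
        (((θ⁻¹ : Matrix.GeneralLinearGroup (Fin (m + 1)) ℤ) :
          Matrix (Fin (m + 1)) (Fin (m + 1)) ℤ).mulVec γ) = γ := mulVec_mulVec_inv θ γ
    let k : HIdx (m + 1) false → ℤ := Sum.elim (((θ⁻¹ : Matrix.GeneralLinearGroup _ ℤ) :
      Matrix (Fin (m + 1)) (Fin (m + 1)) ℤ).mulVec γ) fun j => j.elim0
    have hv3 : v ∈ wtG (fun x => ρ.act (twB θ x)) (fun h => twWt θ lam h + (k h : ℂ)) := by
      rw [wtG_twWt_add]
      simp only [k, Sum.elim_inl]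
      rwa [hk]
    let nu : HIdx m true → ℂ := Sum.elim (fun i => twWt θ lam (.inl i.succ) + (k (.inl i.succ) : ℂ))
      fun _ => twWt θ lam (.inl 0) + (k (.inl 0) : ℂ)
    have hnu : liftWt nu = fun h => twWt θ lam h + (k h : ℂ) := by
      funext h
      rcases h with i | j
      · refine Fin.cases ?_ (fun i => ?_) i <;> rfl
      · exact j.elim0
    refine ⟨⟨v, wt_le_bottom hγ hv1⟩, ?_, rfl⟩
    have : (⟨v, wt_le_bottom hγ hv1⟩ : bottom ρ lam ψ) ∈ wtFullG G nu mu :=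
      (mem_wtFullG_restrict hθ).2 ⟨by rw [hnu]; exact hv3, hv2⟩
    exact Submodule.mem_iSup_of_mem nu (Submodule.mem_iSup_of_mem mu this)
  refine Submodule.eq_top_iff'.2 fun v => ?_
  obtain ⟨y, hy, hyv⟩ := hle v.2
  rwa [← Subtype.ext hyv]

end Final

end

end WSuper

namespace WSuper

/-- Mazorchuk–Zhao alternative for `W(m+1,n)`.
Let `M` be a simple strong Harish-Chandra `W(m+1,n)`-module.  Then either
(1) `M` is strongly cuspidal, or (2) there are `θ ∈ GL_{m+1}(ℤ)` and
`λ ∈ supp(M^θ)` such that `supp(M^θ) ⊆ λ + ℤ_+ ε_0 + ℤ ε_1 + … + ℤ ε_m` and the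
subspace `⊕_{μ ∈ λ + ℤε_1 + … + ℤε_m} (M^θ)_μ` is a simple cuspidal module
over the zero component `W(m,n) ⋉ A d_0` of `W(m+1,n)` (the index `0 : Fin (m+1)`
plays the role of `ε_0`, and `M^θ` is realized by the twisted action
`x ↦ ρ.act (twB θ x)`). -/
theorem strongHC_alternative (m n : ℕ) (ρ : WRep (m + 1) n false)
    (hsimple : IsSimpleG ρ.g) (hstrong : IsStrongHCG ρ.g) :
    IsStronglyCuspidalG ρ.g ∨
      ∃ (θ : Matrix.GeneralLinearGroup (Fin (m + 1)) ℤ)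
        (lam : HIdx (m + 1) false → ℂ),
        -- `λ ∈ supp (M^θ)`
        wtG (fun x => ρ.act (twB θ x)) lam ≠ ⊥ ∧
        -- `supp (M^θ) ⊆ λ + ℤ_+ ε_0 + ℤ ε_1 + … + ℤ ε_m`
        (∀ mu : HIdx (m + 1) false → ℂ,
          wtG (fun x => ρ.act (twB θ x)) mu ≠ ⊥ →
            ∃ k : HIdx (m + 1) false → ℤ,
              0 ≤ k (Sum.inl 0) ∧ mu = fun h => lam h + (k h : ℂ)) ∧
        -- the subspace `⊕_{μ ∈ λ + ℤε_1 + … + ℤε_m} (M^θ)_μ` …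
        (∃ hInv : ∀ x : WBasis m n true,
            ∀ v ∈ (⨆ k ∈ {k : HIdx (m + 1) false → ℤ | k (Sum.inl 0) = 0},
              wtG (fun x => ρ.act (twB θ x)) (fun h => lam h + (k h : ℂ))),
            ρ.act (twB θ (embB x)) v ∈
              (⨆ k ∈ {k : HIdx (m + 1) false → ℤ | k (Sum.inl 0) = 0},
                wtG (fun x => ρ.act (twB θ x)) (fun h => lam h + (k h : ℂ))),
          -- … is a simple cuspidal module over `W(m,n) ⋉ A d_0`.
          IsSimpleG (fun x => (ρ.act (twB θ (embB x))).restrict (hInv x)) ∧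
          IsCuspidalG (fun x => (ρ.act (twB θ (embB x))).restrict (hInv x))) := by
  by_cases hb : IsStronglyCuspidalG ρ.g
  · exact .inl hb
  obtain ⟨lam, ψ, h0, hsurj, hlow, C, hC⟩ := exists_lowest_level hsimple hstrong hb
  obtain ⟨θ, hθ⟩ := exists_gl_of_surjective ψ hsurj
  refine .inr ⟨θ, twWt θ lam, ?_, fun mu hmu => ?_, ?_⟩
  · have h := wtG_twWt_add (ρ := ρ) θ lam 0
    have h2 : (fun i => (0 : HIdx (m + 1) false → ℤ) (.inl i)) = (0 : LExp (m + 1)) := rfl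
    rw [h2, Matrix.mulVec_zero] at h
    simp only [Pi.zero_apply, Int.cast_zero, add_zero] at h
    exact h ▸ h0
  · obtain ⟨k, rfl⟩ := exists_eq_twWt_add θ (iSup_wt_eq_top hsimple h0) hmu
    rw [wtG_twWt_add] at hmu
    exact ⟨k, (hlow _ hmu).trans_eq (hθ _), rfl⟩
  · rw [iSup_wtG_twB hθ]
    exact ⟨act_embB_mem_bottom hθ, isSimpleG_bottom hsimple h0 hlow hθ,
      isCuspidalG_bottom hsimple hstrong h0 hlow hC hθ⟩

end WSuper
end

section
/- Let A = R_m ⊗ Λ, V = W(m,n) or W(m,n) ⋉ A d_0, and let M ≅ A ⊗_Λ U be a strong Harish-Chandra AV-module with U = M_λ a weight space. Then M is an irreducible AV-module if and only if U is an irreducible module over the algebra of differential operators D(Λ, (A#V)_0). -/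
open scoped BigOperators

namespace WSuper

noncomputable section

variable {m n : ℕ}

/-- Basis monomials `t^r ξ^s` of the supercommutative superalgebra `A = R_m ⊗ Λ`. -/
abbrev ABasis (m n : ℕ) := LExp m × GExp n

/-- The supercommutative superalgebra `A = R_m ⊗ Λ` as the free complex vector
space on its monomial basis. -/
abbrev AAlg (m n : ℕ) := ABasis m n →₀ ℂ

def asng (x : ABasis m n) : AAlg m n := Finsupp.single x 1

def aone (m n : ℕ) : AAlg m n := asng (0, fun _ => false)

/-- Product of two monomials of `A`. -/
def amulB (x y : ABasis m n) : AAlg m n :=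
  mulSgn x.2 y.2 • asng (x.1 + y.1, xorE x.2 y.2)

/-- Parity of a monomial of `A`. -/
def apar (x : ABasis m n) : ℕ := gdeg x.2 % 2

/-- The action of a basis element of `W(m,n)` (resp. `W(m,n) ⋉ A d_0`) on a
monomial of `A` by superderivations (`d_0` acts by zero on `A`). -/
def wOnA {b : Bool} : WBasis m n b → ABasis m n → AAlg m n
  | ⟨r, s, .di i⟩, ⟨p, q⟩ => ((p i : ℂ) * mulSgn s q) • asng (r + p, xorE s q)
  | ⟨r, s, .pa α⟩, ⟨p, q⟩ =>
      (derC α q * mulSgn s (derE α q)) • asng (r + p, xorE s (derE α q))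
  | ⟨_, _, .d0⟩, _ => 0

/-- An `AV`-module: compatible actions of the superalgebra `A` and of the Lie
superalgebra `V = W(m,n)` (resp. `W(m,n) ⋉ A d_0`), satisfying the Leibniz rule. -/
structure AVRep (m n : ℕ) (b : Bool) extends WRep m n b where
  aact : AAlg m n →ₗ[ℂ] M →ₗ[ℂ] M
  aact_one : aact (aone m n) = LinearMap.id
  aact_mul : ∀ x y : ABasis m n, aact (amulB x y) = aact (asng x) ∘ₗ aact (asng y)
  leibniz : ∀ (x : WBasis m n b) (f : ABasis m n),
    act (sng x) ∘ₗ aact (asng f)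
      = aact (wOnA x f)
        + ((-1 : ℂ) ^ (par x * apar f)) • (aact (asng f) ∘ₗ act (sng x))

/-- `M` is finitely generated as an `A`-module. -/
def IsFiniteRank {b : Bool} (ρ : AVRep m n b) : Prop :=
  ∃ S : Finset ρ.M,
    Submodule.span ℂ {v : ρ.M | ∃ f : ABasis m n, ∃ s ∈ S, v = ρ.aact (asng f) s} = ⊤

/-- A subspace invariant under both the `A`-action and the `V`-action. -/
def AVInvariant {b : Bool} (ρ : AVRep m n b) (N : Submodule ℂ ρ.M) : Prop :=
  InvariantG ρ.g N ∧ ∀ f : ABasis m n, ∀ v ∈ N, ρ.aact (asng f) v ∈ N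

/-- Irreducibility as an `AV`-module. -/
def AVIsSimple {b : Bool} (ρ : AVRep m n b) : Prop :=
  (∃ v : ρ.M, v ≠ 0) ∧ ∀ N : Submodule ℂ ρ.M, AVInvariant ρ N → N = ⊥ ∨ N = ⊤

/-- A weight module: weight decomposition with respect to `h'`. -/
def IsWeightG {M : Type} [AddCommGroup M] [Module ℂ M] {b : Bool}
    (F : GAct m n b M) : Prop :=
  (⨆ lam, wtG F lam) = ⊤

end

end WSuper

namespace WSuper

noncomputable section

variable {m n : ℕ}

/-- Basis elements `f D(g, r) = t^{-r} f ⊗ t^r g D` (with `f, g` Grassmann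
monomials, `r ∈ ℤ^m`, `D` a direction) of the degree-zero Lie superalgebra
`(A # V)_0` of the smash product. -/
abbrev SBasis (m n : ℕ) (b : Bool) := GExp n × GExp n × LExp m × Dir m n b

/-- The degree-zero component `(A # V)_0` of the Lie superalgebra `A # V`,
as the free complex vector space on its basis. -/
abbrev SAlg (m n : ℕ) (b : Bool) := SBasis m n b →₀ ℂ

def ssng {b : Bool} (x : SBasis m n b) : SAlg m n b := Finsupp.single x 1

/-- Parity of a basis element of `(A # V)_0`. -/
def spar {b : Bool} : SBasis m n b → ℕ
  | ⟨f, g, _, .di _⟩ => (gdeg f + gdeg g) % 2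
  | ⟨f, g, _, .pa _⟩ => (gdeg f + gdeg g + 1) % 2
  | ⟨f, g, _, .d0⟩ => (gdeg f + gdeg g) % 2

/-- The Lie superbracket of `(A # V)_0` on basis elements, obtained from the
smash product bracket
`[f⊗η, g⊗τ] = f η(g) ⊗ τ − (−1)^{(|f|+|η|)(|g|+|τ|)} g τ(f) ⊗ η + (−1)^{|η||g|} fg ⊗ [η,τ]`. -/
def sbr {b : Bool} : SBasis m n b → SBasis m n b → SAlg m n b
  | ⟨f, g, r, D⟩, ⟨f', g', p, D'⟩ =>
      ((wOnA (⟨r, g, D⟩ : WBasis m n b) (-p, f')).sum fun ue c =>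
          (c * mulSgn f ue.2) • ssng (xorE f ue.2, g', p, D'))
      - ((-1 : ℂ) ^ ((gdeg f + par (⟨r, g, D⟩ : WBasis m n b)) *
            (gdeg f' + par (⟨p, g', D'⟩ : WBasis m n b)))) •
          ((wOnA (⟨p, g', D'⟩ : WBasis m n b) (-r, f)).sum fun ue c =>
            (c * mulSgn f' ue.2) • ssng (xorE f' ue.2, g, r, D))
      + ((-1 : ℂ) ^ (par (⟨r, g, D⟩ : WBasis m n b) * gdeg f')) •
          ((brB (⟨r, g, D⟩ : WBasis m n b) ⟨p, g', D'⟩).sum fun wb c =>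
            (c * mulSgn f f') • ssng (xorE f f', wb.2.1, wb.1, wb.2.2))

/-- A module over the Lie superalgebra `(A # V)_0`. -/
structure SRep (m n : ℕ) (b : Bool) where
  U : Type
  [addgrp : AddCommGroup U]
  [mods : Module ℂ U]
  act : SAlg m n b →ₗ[ℂ] U →ₗ[ℂ] U
  super : ∀ x y : SBasis m n b,
    act (sbr x y)
      = act (ssng x) ∘ₗ act (ssng y)
        - ((-1 : ℂ) ^ (spar x * spar y)) • (act (ssng y) ∘ₗ act (ssng x))

attribute [instance] SRep.addgrp SRep.mods

/-- The exterior algebra `Λ = Λ(ξ_1, …, ξ_n)` as free vector space on its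
monomial basis. -/
abbrev LamAlg (n : ℕ) := GExp n →₀ ℂ

def lm (s : GExp n) : LamAlg n := Finsupp.single s 1

/-- Product in `Λ`. -/
def lmul (f g : LamAlg n) : LamAlg n :=
  f.sum fun s a => g.sum fun q c => (a * c * mulSgn s q) • lm (xorE s q)

/-- The derivation `∂_α` of `Λ`. -/
def pdL (α : Fin n) (f : LamAlg n) : LamAlg n :=
  f.sum fun s a => (a * derC α s) • lm (derE α s)

/-- The (Λ-valued) action of a basis element of `(A # V)_0` on a monomial of `Λ`. -/
def sOnL {b : Bool} : SBasis m n b → GExp n → LamAlg n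
  | ⟨F, G, _, .pa α⟩, c =>
      (derC α c * mulSgn G (derE α c) * mulSgn F (xorE G (derE α c))) •
        lm (xorE F (xorE G (derE α c)))
  | ⟨_, _, _, .di _⟩, _ => 0
  | ⟨_, _, _, .d0⟩, _ => 0

/-- A module over the algebra of differential operators `D(Λ, (A#V)_0)`:
compatible actions of `Λ` and of `(A # V)_0`. -/
structure DSRep (m n : ℕ) (b : Bool) extends SRep m n b where
  lact : LamAlg n →ₗ[ℂ] U →ₗ[ℂ] U
  lact_one : lact (lm (fun _ => false)) = LinearMap.id
  lact_mul : ∀ s q : GExp n, lact (lmul (lm s) (lm q)) = lact (lm s) ∘ₗ lact (lm q)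
  compat1 : ∀ (x : SBasis m n b) (f : GExp n),
    act (ssng x) ∘ₗ lact (lm f)
      = lact (sOnL x f)
        + ((-1 : ℂ) ^ (spar x * gdeg f)) • (lact (lm f) ∘ₗ act (ssng x))
  compat2 : ∀ (f : GExp n) (x : SBasis m n b),
    lact (lm f) ∘ₗ act (ssng x)
      = mulSgn f x.1 • act (ssng (xorE f x.1, x.2.1, x.2.2.1, x.2.2.2))

/-- The shift `ε_i` occurring in the polynomial expansion of `D_i(f, r)`. -/
def dsh {b : Bool} (D : Dir m n b) (j : Fin m) : ℤ :=
  match D with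
  | .di i => if j = i then 1 else 0
  | _ => 0

/-- `ε_i` as an integer vector. -/
def epsZ (i : Fin m) : Fin m → ℤ := fun j => if j = i then 1 else 0

end

end WSuper

namespace WSuper

noncomputable section

variable {m n : ℕ}

/-- The operator on an `AV`-module by which a basis element
`f D(g,r) = t^{-r} f ⊗ t^r g D` of `(A#V)_0` acts: first act by the vector
field `t^r g D`, then multiply by `t^{-r} f`. -/
def sOp {b : Bool} (ρ : AVRep m n b) (x : SBasis m n b) : ρ.M →ₗ[ℂ] ρ.M :=
  ρ.aact (asng (-(x.2.2.1), x.1)) ∘ₗ ρ.act (sng (x.2.2.1, x.2.1, x.2.2.2))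

end

section WeightVectors

variable {m n : ℕ} {b : Bool} {M : Type} [AddCommGroup M] [Module ℂ M]

lemma mem_wtG_s5 {F : GAct m n b M} {mu : HIdx m b → ℂ} {v : M} :
    v ∈ wtG F mu ↔ ∀ h, F (hB m n b h) v = mu h • v := by
  simp [wtG, sub_eq_zero]

/-- If a sum of weight vectors of distinct weights lies in a subspace stable under `h'`,
then so does every summand. -/
lemma mem_of_sum_weightVectors_mem {F : GAct m n b M} {N : Submodule ℂ M}
    (hN : ∀ h, ∀ v ∈ N, F (hB m n b h) v ∈ N) {ι : Type*}
    {mu : ι → HIdx m b → ℂ} (hmu : Function.Injective mu) (s : Finset ι) :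
    ∀ w : ι → M, (∀ i, w i ∈ wtG F (mu i)) → ∑ i ∈ s, w i ∈ N → ∀ i ∈ s, w i ∈ N := by
  classical
  induction s using Finset.induction_on with
  | empty => simp
  | insert a s ha ih =>
    intro w hw hsum
    have hs : ∀ i ∈ s, w i ∈ N := by
      intro i hi
      have hia : mu i ≠ mu a := fun h => ha (hmu h ▸ hi)
      obtain ⟨h, hh⟩ := Function.ne_iff.mp hia
      have key : ∑ j ∈ s, (mu j h - mu a h) • w j ∈ N := by
        have h1 := N.sub_mem (hN h _ hsum) (N.smul_mem (mu a h) hsum)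
        rw [map_sum, Finset.smul_sum, ← Finset.sum_sub_distrib, Finset.sum_insert ha,
          mem_wtG_s5.mp (hw a) h, sub_self, zero_add] at h1
        convert h1 using 2 with j
        rw [mem_wtG_s5.mp (hw j) h, sub_smul]
      have h2 := ih (fun j => (mu j h - mu a h) • w j)
        (fun j => Submodule.smul_mem _ _ (hw j)) key i hi
      exact (N.smul_mem_iff (sub_ne_zero.mpr hh)).mp h2
    intro i hi
    rcases Finset.mem_insert.mp hi with rfl | hi
    · rw [Finset.sum_insert ha] at hsum
      exact (N.add_mem_iff_left (N.sum_mem hs)).mp hsum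
    · exact hs i hi

end WeightVectors

section Monomials

variable {m n : ℕ}

lemma mulSgn_zero_left (q : GExp n) : mulSgn (fun _ => false) q = 1 := by
  simp [mulSgn, invCount]

lemma mulSgn_zero_right (q : GExp n) : mulSgn q (fun _ => false) = 1 := by
  simp [mulSgn, invCount]

lemma xorE_zero_left (q : GExp n) : xorE (fun _ => false) q = q := by
  funext a; simp [xorE]

lemma xorE_zero_right (q : GExp n) : xorE q (fun _ => false) = q := by
  funext a; simp [xorE]

lemma apar_laurent (r : LExp m) : apar ((r, fun _ => false) : ABasis m n) = 0 := by
  simp [apar, gdeg]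

/-- A basis vector field maps a Laurent monomial to a multiple of a monomial. -/
lemma exists_wOnA_eq {b : Bool} (p : LExp m) (s : GExp n) (D : Dir m n b) (q : LExp m) :
    ∃ (c : ℂ) (s' : GExp n),
      wOnA (p, s, D) (q, fun _ => false) = c • asng (p + q, s') := by
  cases D with
  | di i => exact ⟨_, _, rfl⟩
  | pa a => exact ⟨_, _, rfl⟩
  | d0 => exact ⟨0, s, by simp [wOnA]⟩

/-- The weight `λ + k`, where `k ∈ ℤ^m` shifts the eigenvalues of `d_1, …, d_m`. -/
def shiftWt {b : Bool} (lam : HIdx m b → ℂ) (k : LExp m) : HIdx m b → ℂ :=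
  fun h => lam h + Sum.elim (fun i => (k i : ℂ)) (fun _ => 0) h

lemma shiftWt_injective {b : Bool} (lam : HIdx m b → ℂ) :
    Function.Injective (shiftWt lam) := by
  intro k l h
  funext i
  simpa [shiftWt] using congrFun h (.inl i)

lemma shiftWt_zero {b : Bool} (lam : HIdx m b → ℂ) : shiftWt lam 0 = lam := by
  funext h
  rcases h with i | i <;> simp [shiftWt]

lemma shiftWt_add {b : Bool} (lam : HIdx m b → ℂ) (k l : LExp m) :
    shiftWt (shiftWt lam k) l = shiftWt lam (k + l) := by
  funext h
  rcases h with i | i <;> simp [shiftWt, add_assoc]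

end Monomials

namespace AVRep

variable {m n : ℕ} {b : Bool} (ρ : AVRep m n b)

/-- Multiplication by the Laurent monomial `t^r`. -/
noncomputable def laurent (r : LExp m) : ρ.M →ₗ[ℂ] ρ.M :=
  ρ.aact (asng (r, fun _ => false))

lemma laurent_zero (v : ρ.M) : ρ.laurent 0 v = v :=
  LinearMap.congr_fun ρ.aact_one v

lemma laurent_aact (r p : LExp m) (s : GExp n) (v : ρ.M) :
    ρ.laurent r (ρ.aact (asng (p, s)) v) = ρ.aact (asng (r + p, s)) v := by
  have h := LinearMap.congr_fun (ρ.aact_mul (r, fun _ => false) (p, s)) v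
  simpa [amulB, mulSgn_zero_left, xorE_zero_left, laurent] using h.symm

lemma aact_laurent (r p : LExp m) (s : GExp n) (v : ρ.M) :
    ρ.aact (asng (p, s)) (ρ.laurent r v) = ρ.aact (asng (p + r, s)) v := by
  have h := LinearMap.congr_fun (ρ.aact_mul (p, s) (r, fun _ => false)) v
  simpa [amulB, mulSgn_zero_right, xorE_zero_right, laurent] using h.symm

lemma laurent_laurent (r p : LExp m) (v : ρ.M) :
    ρ.laurent r (ρ.laurent p v) = ρ.laurent (r + p) v :=
  ρ.laurent_aact r p _ v

lemma laurent_neg_self (r : LExp m) (v : ρ.M) : ρ.laurent r (ρ.laurent (-r) v) = v := by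
  rw [laurent_laurent, add_neg_cancel, laurent_zero]

lemma laurent_self_neg (r : LExp m) (v : ρ.M) : ρ.laurent (-r) (ρ.laurent r v) = v := by
  rw [laurent_laurent, neg_add_cancel, laurent_zero]

lemma act_laurent (x : WBasis m n b) (r : LExp m) (v : ρ.M) :
    ρ.act (sng x) (ρ.laurent r v)
      = ρ.aact (wOnA x (r, fun _ => false)) v + ρ.laurent r (ρ.act (sng x) v) := by
  have h := LinearMap.congr_fun (ρ.leibniz x (r, fun _ => false)) v
  simpa [apar_laurent, laurent] using h

lemma laurent_mem_wtG {mu : HIdx m b → ℂ} {v : ρ.M} (hv : v ∈ wtG ρ.g mu) (r : LExp m) :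
    ρ.laurent r v ∈ wtG ρ.g (shiftWt mu r) := by
  rw [mem_wtG_s5] at hv ⊢
  intro h
  have hv' := hv h
  simp only [WRep.g] at hv' ⊢
  rw [act_laurent, hv', map_smul]
  rcases h with i | i
  · simp [hB, wOnA, mulSgn_zero_left, xorE_zero_left, shiftWt, add_smul, laurent, add_comm]
  · cases b with
    | false => exact i.elim0
    | true => simp [hB, wOnA, shiftWt]

lemma laurent_neg_mem_wtG {lam : HIdx m b → ℂ} {r : LExp m} {v : ρ.M}
    (hv : v ∈ wtG ρ.g (shiftWt lam r)) : ρ.laurent (-r) v ∈ wtG ρ.g lam := by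
  simpa only [shiftWt_add, add_neg_cancel, shiftWt_zero] using ρ.laurent_mem_wtG hv (-r)

lemma laurent_sOp (p r : LExp m) (s : GExp n) (D : Dir m n b) (v : ρ.M) :
    ρ.laurent (p + r) (sOp ρ (fun _ => false, s, p, D) v)
      = ρ.laurent r (ρ.act (sng (p, s, D)) v) := by
  change ρ.laurent (p + r) (ρ.laurent (-p) _) = _
  rw [laurent_laurent]
  congr 2
  abel

/-- The subspace `∑_r t^r Q`; it is the `A`-submodule generated by `Q` when `Q` is `Λ`-stable. -/
noncomputable def generated (Q : Submodule ℂ ρ.M) : Submodule ℂ ρ.M :=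
  ⨆ r : LExp m, Q.map (ρ.laurent r)

variable {ρ}

lemma laurent_mem_generated {Q : Submodule ℂ ρ.M} {v : ρ.M} (hv : v ∈ Q) (r : LExp m) :
    ρ.laurent r v ∈ ρ.generated Q :=
  Submodule.mem_iSup_of_mem r (Submodule.mem_map_of_mem hv)

lemma generated_le {Q N : Submodule ℂ ρ.M} (h : ∀ r, ∀ v ∈ Q, ρ.laurent r v ∈ N) :
    ρ.generated Q ≤ N :=
  iSup_le fun r => Submodule.map_le_iff_le_comap.mpr (h r)

lemma avInvariant_generated {Q : Submodule ℂ ρ.M}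
    (hL : ∀ f : GExp n, ∀ v ∈ Q, ρ.aact (asng ((0 : LExp m), f)) v ∈ Q)
    (hS : ∀ x : SBasis m n b, ∀ v ∈ Q, sOp ρ x v ∈ Q) :
    AVInvariant ρ (ρ.generated Q) := by
  have hA : ∀ (p : LExp m) (s : GExp n), ∀ v ∈ Q,
      ρ.aact (asng (p, s)) v ∈ ρ.generated Q := by
    intro p s v hv
    have h := laurent_mem_generated (hL s v hv) p
    rwa [laurent_aact, add_zero] at h
  refine ⟨?_, ?_⟩
  · rintro ⟨p, s, D⟩
    refine generated_le (N := (ρ.generated Q).comap (ρ.g (p, s, D))) fun r v hv => ?_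
    change ρ.act (sng (p, s, D)) (ρ.laurent r v) ∈ ρ.generated Q
    rw [act_laurent, ← laurent_sOp]
    obtain ⟨c, s', hc⟩ := exists_wOnA_eq p s D r
    refine Submodule.add_mem _ ?_ (laurent_mem_generated (hS _ v hv) _)
    rw [hc, map_smul]
    exact Submodule.smul_mem _ c (hA _ _ v hv)
  · rintro ⟨p, s⟩
    refine generated_le (N := (ρ.generated Q).comap (ρ.aact (asng (p, s)))) fun r v hv => ?_
    rw [Submodule.mem_comap, aact_laurent]
    exact hA _ _ v hv

/-- The weight space of weight `λ` of `∑_r t^r Q` is contained in `Q` when `Q ⊆ M_λ`. -/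
lemma generated_inf_wtG_le {Q : Submodule ℂ ρ.M} {lam : HIdx m b → ℂ}
    (hQ : Q ≤ wtG ρ.g lam) : ρ.generated Q ⊓ wtG ρ.g lam ≤ Q := by
  classical
  rintro u ⟨hu, hlam⟩
  obtain ⟨w, hw, hsum⟩ := (Submodule.mem_iSup_iff_exists_finsupp _ _).mp hu
  have hwt : ∀ r, w r ∈ wtG ρ.g (shiftWt lam r) := by
    intro r
    obtain ⟨q, hq, hqr⟩ := hw r
    rw [← hqr]
    exact ρ.laurent_mem_wtG (hQ hq) r
  have hzero : w 0 - u = 0 := by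
    have h := mem_of_sum_weightVectors_mem (F := ρ.g) (N := ⊥) (by simp)
      (shiftWt_injective lam) (insert 0 w.support)
      (fun r => w r - if r = 0 then u else 0) ?_ ?_ 0 (Finset.mem_insert_self _ _)
    · simpa using h
    · intro r
      refine Submodule.sub_mem _ (hwt r) ?_
      split_ifs with hr
      · rwa [hr, shiftWt_zero]
      · exact Submodule.zero_mem _
    · have h2 : ∑ r ∈ insert 0 w.support, w r = u := by
        rw [← hsum]
        refine (Finset.sum_subset (Finset.subset_insert _ _) fun r _ hr => ?_).symm
        simpa using hr
      simp [Finset.sum_sub_distrib, h2]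
  obtain ⟨q, hq, hqr⟩ := hw 0
  rw [laurent_zero] at hqr
  rwa [← sub_eq_zero.mp hzero, ← hqr]

/-- An `AV`-invariant subspace of a weight module meeting no weight space is zero. -/
lemma eq_bot_of_inf_wtG_eq_bot (hwt : IsWeightG ρ.g) {N : Submodule ℂ ρ.M}
    (hN : AVInvariant ρ N) (h : ∀ mu, ∀ v ∈ N, v ∈ wtG ρ.g mu → v = 0) : N = ⊥ := by
  rw [eq_bot_iff]
  intro v hv
  obtain ⟨w, hw, hsum⟩ := (Submodule.mem_iSup_iff_exists_finsupp _ v).mp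
    (hwt ▸ Submodule.mem_top : v ∈ ⨆ mu, wtG ρ.g mu)
  have hmem := mem_of_sum_weightVectors_mem (F := ρ.g) (N := N) (fun h => hN.1 _)
    (mu := fun mu => mu) Function.injective_id w.support w hw (by rwa [← hsum] at hv)
  rw [Submodule.mem_bot, ← hsum]
  exact Finset.sum_eq_zero fun mu hmu => h mu _ (hmem mu hmu) (hw mu)

end AVRep

/-- Let `A = R_m ⊗ Λ`, `V = W(m,n)` (`b = false`) or
`W(m,n) ⋉ A d_0` (`b = true`), and let `M ≅ A ⊗_Λ U` be a strong Harish-Chandra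
`AV`-module whose support lies in `λ + ℤ^m` and whose weight space `U = M_λ`
(which is invariant under the `Λ`-action and under `(A#V)_0`).  Then `M` is an
irreducible `AV`-module if and only if `U` is an irreducible module over the
algebra of differential operators `D(Λ, (A#V)_0)`, i.e. `U` is nonzero and has
no proper nonzero subspace invariant under both the `Λ`-action and the
`(A#V)_0`-action. -/
theorem irreducible_iff_weightSpace_irreducible (m n : ℕ) (b : Bool)
    (ρ : AVRep m n b) (lam : HIdx m b → ℂ)
    (hstrong : IsStrongHCG ρ.g)
    -- the support of `M` lies in `λ + ℤ^m`
    (hsupp : ∀ mu : HIdx m b → ℂ, wtG ρ.g mu ≠ ⊥ →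
      ∃ k : Fin m → ℤ,
        mu = fun h => lam h + Sum.elim (fun i => (k i : ℂ)) (fun _ => 0) h)
    -- `U = M_λ` is invariant under the `Λ`-action …
    (hL : ∀ f : GExp n, ∀ v ∈ wtG ρ.g lam,
      ρ.aact (asng ((0 : LExp m), f)) v ∈ wtG ρ.g lam)
    -- … and under the action of `(A#V)_0`
    (hS : ∀ x : SBasis m n b, ∀ v ∈ wtG ρ.g lam, sOp ρ x v ∈ wtG ρ.g lam) :
    AVIsSimple ρ ↔
      ((∃ u : ↥(wtG ρ.g lam), u ≠ 0) ∧
        ∀ P : Submodule ℂ ↥(wtG ρ.g lam),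
          (∀ f : GExp n, ∀ u ∈ P,
              (ρ.aact (asng ((0 : LExp m), f))).restrict (hL f) u ∈ P) →
          (∀ x : SBasis m n b, ∀ u ∈ P, (sOp ρ x).restrict (hS x) u ∈ P) →
          P = ⊥ ∨ P = ⊤) := by
  have hwt : IsWeightG ρ.g := hstrong.1
  constructor
  · rintro ⟨⟨v, hv⟩, hsimple⟩
    refine ⟨?_, fun P hPL hPS => ?_⟩
    · by_contra! hU
      have hbot : ∀ mu, wtG ρ.g mu = ⊥ := by
        intro mu
        by_contra hne
        obtain ⟨k, rfl⟩ := hsupp mu hne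
        refine hne ((Submodule.eq_bot_iff _).mpr fun w hw => ?_)
        have h0 : ρ.laurent (-k) w = 0 :=
          congrArg Subtype.val (hU ⟨_, ρ.laurent_neg_mem_wtG (r := k) hw⟩)
        rw [← ρ.laurent_neg_self k w, h0, map_zero]
      have htop : (⊥ : Submodule ℂ ρ.M) = ⊤ := by
        rw [← hwt]
        simp [hbot]
      exact hv ((Submodule.mem_bot ℂ).mp (htop ▸ Submodule.mem_top))
    · set Q := P.map (wtG ρ.g lam).subtype with hQ
      have hQlam : Q ≤ wtG ρ.g lam := Submodule.map_subtype_le _ _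
      have hinv : AVInvariant ρ (ρ.generated Q) := by
        apply AVRep.avInvariant_generated
        · rintro f _ ⟨u, hu, rfl⟩
          exact ⟨_, hPL f u hu, rfl⟩
        · rintro x _ ⟨u, hu, rfl⟩
          exact ⟨_, hPS x u hu, rfl⟩
      rcases hsimple _ hinv with h | h
      · left
        rw [Submodule.eq_bot_iff]
        intro u hu
        have hmem := AVRep.laurent_mem_generated (Q := Q) (Submodule.mem_map_of_mem hu) 0
        rw [h, AVRep.laurent_zero] at hmem
        exact Subtype.ext ((Submodule.mem_bot ℂ).mp hmem)
      · right
        rw [Submodule.eq_top_iff']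
        intro u
        obtain ⟨u', hu', he⟩ :=
          AVRep.generated_inf_wtG_le hQlam ⟨h ▸ Submodule.mem_top, u.2⟩
        rwa [← Subtype.ext he]
  · rintro ⟨⟨u, hu⟩, hsimple⟩
    refine ⟨⟨u, fun h => hu (Subtype.ext h)⟩, fun N hN => ?_⟩
    have hmem : ∀ (r : LExp m), ∀ v ∈ N, ρ.laurent r v ∈ N := fun r => hN.2 _
    rcases hsimple (N.comap (wtG ρ.g lam).subtype) (fun f u hu => hN.2 _ _ hu)
      (fun x u hu => hN.2 _ _ (hN.1 _ _ hu)) with h | h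
    · left
      refine AVRep.eq_bot_of_inf_wtG_eq_bot hwt hN fun mu v hv hvmu => ?_
      by_contra hv0
      obtain ⟨k, rfl⟩ := hsupp mu (Submodule.ne_bot_iff _ |>.mpr ⟨v, hvmu, hv0⟩)
      have hk : (⟨_, ρ.laurent_neg_mem_wtG (r := k) hvmu⟩ : wtG ρ.g lam) ∈
          N.comap (wtG ρ.g lam).subtype := hmem _ v hv
      rw [h, Submodule.mem_bot] at hk
      have h0 : ρ.laurent (-k) v = 0 := congrArg Subtype.val hk
      exact hv0 (by rw [← ρ.laurent_neg_self k v, h0, map_zero])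
    · right
      rw [eq_top_iff, ← hwt]
      refine iSup_le fun mu => ?_
      by_cases hne : wtG ρ.g mu = ⊥
      · simp [hne]
      obtain ⟨k, rfl⟩ := hsupp mu hne
      intro v hv
      have hk : (⟨_, ρ.laurent_neg_mem_wtG (r := k) hv⟩ : wtG ρ.g lam) ∈
          N.comap (wtG ρ.g lam).subtype := h ▸ Submodule.mem_top
      rw [← ρ.laurent_neg_self k v]
      exact hmem k _ hk


end WSuper
end
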